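/- There exists ε₁ > 0 such that for any 0 < ε₂ < 1/5, c > 0 and s ≥ 20, there exist d₀ = d₀(ε₁,ε₂,s) and a constant 0 < t₃ < c/3 such that the following holds for each n ≥ d ≥ d₀ with d < log^s n. Suppose G is an n-vertex bipartite (ε₁, ε₂·d)-expander with minimum degree δ(G) ≥ d which is TK_{d/2}^(2)-free, and suppose at least 2·t₃·d vertices of G have degree at least Δ = c²·d²·log^{10} n. Then G contains an ℓ-balanced subdivision TK_k^(ℓ) of the complete graph with k ≥ t₃·d, for some ℓ ∈ ℕ. -/

import Mathlib

open Real

namespace Balanced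

variable {V : Type*}

/-- The external neighbourhood of a vertex set `X` in `G`. -/
def extNbr (G : SimpleGraph V) (X : Set V) : Set V := {v | v ∉ X ∧ ∃ u ∈ X, G.Adj u v}

/-- The Komlós–Szemerédi expansion function `ε(x, ε₁, k)`. -/
noncomputable def epsFn (ε₁ k x : ℝ) : ℝ :=
  if x < k / 5 then 0 else ε₁ / (Real.log (15 * x / k)) ^ 2

/-- `G` is an `(ε₁, k)`-expander. -/
def IsExpander (G : SimpleGraph V) (ε₁ k : ℝ) : Prop :=
  ∀ X : Set V, k / 2 ≤ (X.ncard : ℝ) → (X.ncard : ℝ) ≤ (Nat.card V : ℝ) / 2 →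
    epsFn ε₁ k (X.ncard : ℝ) * (X.ncard : ℝ) ≤ ((extNbr G X).ncard : ℝ)

/-- `G` is bipartite. -/
def IsBip (G : SimpleGraph V) : Prop := ∃ f : V → Bool, ∀ u v, G.Adj u v → f u ≠ f v

/-- The average degree `2|E(G)|/|V(G)|` of `G`. -/
noncomputable def avgDeg (G : SimpleGraph V) : ℝ :=
  2 * (Nat.card G.edgeSet : ℝ) / (Nat.card V : ℝ)

/-- The minimum degree of `G` is at least `d`. -/
def MinDegGE (G : SimpleGraph V) (d : ℝ) : Prop :=
  ∀ v : V, d ≤ ((G.neighborSet v).ncard : ℝ)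

/-- The support of a walk, as a set of vertices. -/
def suppSet {G : SimpleGraph V} {a b : V} (w : G.Walk a b) : Set V := {x | x ∈ w.support}

/-- `G` contains an `ℓ`-balanced subdivision `TK_k^(ℓ)` of the complete graph `K_k`:
there are `k` core vertices joined pairwise by internally vertex-disjoint paths of
length exactly `ℓ`, whose internal vertices avoid all core vertices. -/
def ContainsBalSub (G : SimpleGraph V) (k ℓ : ℕ) : Prop :=
  ∃ c : Fin k → V, Function.Injective c ∧
    ∃ P : ∀ i j : Fin k, i < j → G.Walk (c i) (c j),
      (∀ i j (h : i < j), (P i j h).IsPath ∧ (P i j h).length = ℓ) ∧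
      (∀ i j (h : i < j) (q : Fin k), c q ∈ (P i j h).support → q = i ∨ q = j) ∧
      (∀ i j (h : i < j) i' j' (h' : i' < j'), (i, j) ≠ (i', j') →
        ∀ x, x ∈ (P i j h).support → x ∈ (P i' j' h').support →
          (x = c i ∨ x = c j) ∧ (x = c i' ∨ x = c j'))

/-- The subgraph `F` of `G` is a `(D, m)`-expansion of the vertex `v`:
`|V(F)| = D` and every vertex of `F` is at distance at most `m` from `v` in `F`. -/
def IsExpansion (G : SimpleGraph V) (F : G.Subgraph) (v : V) (D m : ℝ) : Prop :=
  ∃ hv : v ∈ F.verts, ((F.verts.ncard : ℝ) = D ∧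
    ∀ u, ∀ hu : u ∈ F.verts, ∃ w : F.coe.Walk ⟨v, hv⟩ ⟨u, hu⟩, (w.length : ℝ) ≤ m)

/-- `G` contains a `(D, m, k)`-adjuster. -/
def HasAdjuster (G : SimpleGraph V) (D m : ℝ) (k : ℕ) : Prop :=
  ∃ (v₁ v₂ : V) (F₁ F₂ : G.Subgraph) (A : Set V),
    Disjoint A F₁.verts ∧ Disjoint A F₂.verts ∧ Disjoint F₁.verts F₂.verts ∧
    IsExpansion G F₁ v₁ D m ∧ IsExpansion G F₂ v₂ D m ∧
    (A.ncard : ℝ) ≤ 10 * m * (k : ℝ) ∧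
    ∃ ℓ : ℕ, ∀ i : ℕ, i ≤ k → ∃ w : G.Walk v₁ v₂, w.IsPath ∧
      w.length = ℓ + 2 * i ∧ ∀ x ∈ w.support, x ∈ A ∪ {v₁, v₂}

open Classical in
/-- `π(u, v, G)` for a connected bipartite graph `G`: `0` if `u = v`, `1` if `u, v`
lie in different classes of the bipartition (equivalently, are joined by an odd walk),
and `2` otherwise. -/
noncomputable def piVal (G : SimpleGraph V) (u v : V) : ℕ :=
  if u = v then 0 else if ∃ w : G.Walk u v, Odd w.length then 1 else 2

/-- The ball of radius `r` around `v` in the subgraph of `G` induced on `S`,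
viewed as a subset of `V`. -/
def ballIn (G : SimpleGraph V) (S : Set V) (v : V) (r : ℕ) : Set V :=
  {u | ∃ w : G.Walk v u, w.length ≤ r ∧ ∀ x ∈ w.support, x ∈ S}

/-- The ball of radius `r` around the set `Y` in the subgraph of `G` induced on `S`. -/
def ballSetIn (G : SimpleGraph V) (S : Set V) (Y : Set V) (r : ℕ) : Set V :=
  {u | ∃ y ∈ Y, ∃ w : G.Walk y u, w.length ≤ r ∧ ∀ x ∈ w.support, x ∈ S}

/-- `P 0, …, P (q-1)` are consecutive shortest paths from `v` in the vertex set `W`: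
each `P i` is a shortest path between its endpoints in the graph induced on
`(W \ ⋃_{j<i} V(P j)) ∪ {v}`. -/
def ConsecSP (G : SimpleGraph V) (v : V) (W : Set V) {q : ℕ}
    (P : Fin q → Σ u : V, G.Walk v u) : Prop :=
  ∀ i : Fin q,
    (∀ x ∈ suppSet (P i).2,
      x ∈ (W \ ⋃ (j : Fin q) (_ : j < i), suppSet (P j).2) ∪ {v}) ∧
    ((P i).2).IsPath ∧
    ∀ w' : G.Walk v (P i).1,
      (∀ x ∈ suppSet w',
        x ∈ (W \ ⋃ (j : Fin q) (_ : j < i), suppSet (P j).2) ∪ {v}) →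
      ((P i).2).length ≤ w'.length

/-- `v` is an end vertex of the path `p`. -/
def IsEnd (G : SimpleGraph V) (v : V) (p : Σ a b : V, G.Walk a b) : Prop :=
  v = p.1 ∨ v = p.2.1

/-- `t` is the subpath `p(v, r)` of `p` of length `r` having `v` as an end vertex. -/
def IsTrunc (G : SimpleGraph V) (r : ℕ) (p : Σ a b : V, G.Walk a b) (v : V)
    (t : Σ u : V, G.Walk v u) : Prop :=
  t.2.length = r ∧ ∃ (c : V) (w' : G.Walk t.1 c),
    (⟨v, c, t.2.append w'⟩ : Σ a b : V, G.Walk a b) = p ∨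
    (⟨v, c, t.2.append w'⟩ : Σ a b : V, G.Walk a b) = ⟨p.2.1, p.1, p.2.2.reverse⟩

/-- A sequence growing by a factor `1 + 1/η` per step doubles every `η` steps. -/
lemma growth_exceeds {f : ℕ → ℕ} {η a B : ℕ} (hη : 0 < η) (hmono : Monotone f) (h0 : 1 ≤ f 0)
    (hB : B ≤ 2 ^ a) (hstep : ∀ i < η * a, f i < B → (η + 1) * f i ≤ η * f (i + 1)) :
    B ≤ f (η * a) := by
  by_contra! hlt
  have hall : ∀ i ≤ η * a, f i < B := fun i hi => (hmono hi).trans_lt hlt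
  have hlin : ∀ i t, i + t ≤ η * a → (η + t) * f i ≤ η * f (i + t) := by
    intro i t
    induction t with
    | zero => simp
    | succ t ih =>
      intro h
      have h1 := ih (by omega)
      have h2 := hstep (i + t) (by omega) (hall _ (by omega))
      have h3 : f i ≤ f (i + t) := hmono (by omega)
      rw [← add_assoc, ← add_assoc]
      nlinarith
  have hdbl : ∀ b ≤ a, 2 ^ b ≤ f (η * b) := by
    intro b
    induction b with
    | zero => simpa using h0
    | succ b ih =>
      intro hb
      have h1 := ih (by omega)
      have h2 := hlin (η * b) η (by nlinarith)
      have h3 : 2 * f (η * b) ≤ f (η * b + η) := by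
        have : η * (2 * f (η * b)) ≤ η * f (η * b + η) := by linarith
        exact Nat.le_of_mul_le_mul_left this hη
      rw [pow_succ, mul_add, mul_one]
      omega
  exact absurd (hdbl a le_rfl) (by omega)

/-- The graph obtained from `G` by isolating all vertices of `W`. -/
def del (G : SimpleGraph V) (W : Finset V) : SimpleGraph V where
  Adj u v := G.Adj u v ∧ u ∉ W ∧ v ∉ W
  symm := ⟨fun _ _ h => ⟨h.1.symm, h.2.2, h.2.1⟩⟩
  loopless := ⟨fun _ h => h.1.ne rfl⟩

lemma del_le (G : SimpleGraph V) (W : Finset V) : del G W ≤ G := fun _ _ h => h.1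

lemma del_anti (G : SimpleGraph V) {W W' : Finset V} (h : W ⊆ W') : del G W' ≤ del G W :=
  fun _ _ hh => ⟨hh.1, fun hm => hh.2.1 (h hm), fun hm => hh.2.2 (h hm)⟩

lemma walk_del_avoid {G : SimpleGraph V} {W : Finset V} {u v : V} (p : (del G W).Walk u v)
    (hu : u ∉ W) : ∀ x ∈ p.support, x ∉ W := by
  induction p with
  | nil => simpa using hu
  | cons h p ih =>
    intro x hx
    rw [SimpleGraph.Walk.support_cons, List.mem_cons] at hx
    rcases hx with rfl | hx
    · exact hu
    · exact ih h.2.2 x hx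

open Classical in
/-- The external neighbourhood of a finite set. -/
noncomputable def bdry [Fintype V] (H : SimpleGraph V) (X : Finset V) : Finset V :=
  Finset.univ.filter fun v => v ∉ X ∧ ∃ u ∈ X, H.Adj u v

open Classical in
/-- The ball of radius `i` around `v`. -/
noncomputable def ball [Fintype V] (H : SimpleGraph V) (v : V) (i : ℕ) : Finset V :=
  Finset.univ.filter fun u => ∃ p : H.Walk v u, p.length ≤ i

open Classical in
/-- The neighbours of `v` inside `X`. -/
noncomputable def nbrIn (G : SimpleGraph V) (v : V) (X : Finset V) : Finset V :=
  X.filter fun u => G.Adj v u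

lemma mem_nbrIn {G : SimpleGraph V} {X : Finset V} {v u : V} :
    u ∈ nbrIn G v X ↔ u ∈ X ∧ G.Adj v u := by simp [nbrIn]

section
variable [Fintype V]

lemma mem_bdry {H : SimpleGraph V} {X : Finset V} {v : V} :
    v ∈ bdry H X ↔ v ∉ X ∧ ∃ u ∈ X, H.Adj u v := by simp [bdry]

lemma mem_ball {H : SimpleGraph V} {v u : V} {i : ℕ} :
    u ∈ ball H v i ↔ ∃ p : H.Walk v u, p.length ≤ i := by simp [ball]

lemma self_mem_ball (H : SimpleGraph V) (v : V) (i : ℕ) : v ∈ ball H v i :=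
  mem_ball.2 ⟨.nil, by simp⟩

lemma ball_mono (H : SimpleGraph V) (v : V) : Monotone (ball H v) := by
  intro i j hij u hu
  obtain ⟨p, hp⟩ := mem_ball.1 hu
  exact mem_ball.2 ⟨p, hp.trans hij⟩

lemma ball_mono_graph {H H' : SimpleGraph V} (h : H ≤ H') (v : V) (i : ℕ) :
    ball H v i ⊆ ball H' v i := by
  intro u hu
  obtain ⟨p, hp⟩ := mem_ball.1 hu
  exact mem_ball.2 ⟨p.mapLe h, by simpa using hp⟩

lemma adj_mem_ball {H : SimpleGraph V} {v u w : V} {i : ℕ} (hu : u ∈ ball H v i)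
    (h : H.Adj u w) : w ∈ ball H v (i + 1) := by
  obtain ⟨p, hp⟩ := mem_ball.1 hu
  exact mem_ball.2 ⟨p.concat h, by simpa using hp⟩

lemma bdry_ball_subset (H : SimpleGraph V) (v : V) (i : ℕ) :
    bdry H (ball H v i) ⊆ ball H v (i + 1) := by
  intro w hw
  obtain ⟨-, u, hu, h⟩ := mem_bdry.1 hw
  exact adj_mem_ball hu h

lemma disjoint_bdry (H : SimpleGraph V) (X : Finset V) : Disjoint X (bdry H X) := by
  rw [Finset.disjoint_left]
  intro v hv hv'
  exact (mem_bdry.1 hv').1 hv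

lemma card_ball_add_card_bdry_le (H : SimpleGraph V) (v : V) (i : ℕ) :
    (ball H v i).card + (bdry H (ball H v i)).card ≤ (ball H v (i + 1)).card := by
  classical
  rw [← Finset.card_union_of_disjoint (disjoint_bdry _ _)]
  exact Finset.card_le_card
    (Finset.union_subset (ball_mono H v (Nat.le_succ i)) (bdry_ball_subset H v i))

lemma ball_del_disjoint {G : SimpleGraph V} {W : Finset V} {v : V} (hv : v ∉ W) (i : ℕ) :
    Disjoint (ball (del G W) v i) W := by
  rw [Finset.disjoint_left]
  intro u hu
  obtain ⟨p, -⟩ := mem_ball.1 hu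
  exact walk_del_avoid p hv u p.end_mem_support

/-- Every vertex of a walk of length at most `i` from `v` lies in the ball of radius `i`. -/
lemma support_subset_ball {H : SimpleGraph V} {v u : V} (p : H.Walk v u) {x : V}
    (hx : x ∈ p.support) : x ∈ ball H v p.length := by
  classical
  exact mem_ball.2 ⟨p.takeUntil x hx, p.length_takeUntil_le_length hx⟩

/-- If two vertices have large balls and large sets keep expanding, they are joined by a short
walk. -/
lemma exists_path_of_large_balls {H : SimpleGraph V} {u v : V} {m η a D : ℕ} (hη : 0 < η)
    (hn : Fintype.card V < 2 ^ a)
    (hexp : ∀ X : Finset V, D ≤ X.card → 2 * X.card ≤ Fintype.card V →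
      X.card ≤ η * (bdry H X).card)
    (hu : D ≤ (ball H u m).card) (hv : D ≤ (ball H v m).card) :
    ∃ p : H.Walk u v, p.IsPath ∧ p.length ≤ 2 * (m + η * a) := by
  classical
  have key : ∀ w, D ≤ (ball H w m).card →
      Fintype.card V / 2 + 1 ≤ (ball H w (m + η * a)).card := by
    intro w hw
    refine growth_exceeds (f := fun i => (ball H w (m + i)).card) hη
      (fun i j hij => Finset.card_le_card (ball_mono H w (by omega)))
      (Finset.card_pos.2 ⟨w, self_mem_ball H w _⟩) (by omega) ?_
    intro i _ hi
    have h1 := hexp (ball H w (m + i))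
      (hw.trans (Finset.card_le_card (ball_mono H w (by omega)))) (by omega)
    have h2 := card_ball_add_card_bdry_le H w (m + i)
    rw [← add_assoc]
    nlinarith
  obtain ⟨x, hx⟩ : ∃ x, x ∈ ball H u (m + η * a) ∩ ball H v (m + η * a) := by
    by_contra! hcon
    have hdis : Disjoint (ball H u (m + η * a)) (ball H v (m + η * a)) :=
      Finset.disjoint_iff_inter_eq_empty.2 (Finset.eq_empty_of_forall_notMem hcon)
    have h1 := Finset.card_union_of_disjoint hdis
    have h2 := Finset.card_le_univ (ball H u (m + η * a) ∪ ball H v (m + η * a))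
    have := key u hu
    have := key v hv
    omega
  rw [Finset.mem_inter] at hx
  obtain ⟨p, hp⟩ := mem_ball.1 hx.1
  obtain ⟨q, hq⟩ := mem_ball.1 hx.2
  refine ⟨(p.append q.reverse).bypass, SimpleGraph.Walk.bypass_isPath _, ?_⟩
  refine (SimpleGraph.Walk.length_bypass_le_length _).trans ?_
  rw [SimpleGraph.Walk.length_append, SimpleGraph.Walk.length_reverse]
  omega

end

section
variable [Fintype V]

lemma coe_bdry (H : SimpleGraph V) (X : Finset V) : (bdry H X : Set V) = extNbr H (X : Set V) := by
  ext v
  simp [mem_bdry, extNbr]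

/-- The expansion property for finite sets with an upper bound on the logarithm. -/
lemma IsExpander.card_le {G : SimpleGraph V} {k M : ℝ} (hG : IsExpander G 1 k) (hk : 0 < k)
    {X : Finset V} (h1 : k / 2 ≤ X.card) (h2 : 2 * X.card ≤ Fintype.card V)
    (hM : Real.log (15 * X.card / k) ≤ M) : (X.card : ℝ) ≤ M ^ 2 * (bdry G X).card := by
  have hX : (0 : ℝ) < X.card := lt_of_lt_of_le (by positivity) h1
  have hlog : 0 < Real.log (15 * X.card / k) := by
    apply Real.log_pos
    rw [lt_div_iff₀ hk]
    linarith
  have h2' : (X.card : ℝ) ≤ (Fintype.card V : ℝ) / 2 := by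
    have : (2 * X.card : ℝ) ≤ Fintype.card V := by exact_mod_cast h2
    linarith
  have h := hG (X : Set V) (by simpa [Set.ncard_coe_finset] using h1)
    (by simpa [Set.ncard_coe_finset, Nat.card_eq_fintype_card] using h2')
  rw [← coe_bdry, Set.ncard_coe_finset, Set.ncard_coe_finset, epsFn, if_neg (by linarith),
    div_mul_eq_mul_div, one_mul, div_le_iff₀ (by positivity)] at h
  calc (X.card : ℝ) ≤ (bdry G X).card * Real.log (15 * X.card / k) ^ 2 := h
    _ ≤ (bdry G X).card * M ^ 2 := by gcongr
    _ = _ := mul_comm _ _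

open Classical in
lemma bdry_sdiff_subset (G : SimpleGraph V) (W X : Finset V) :
    bdry G (X \ W) ⊆ bdry (del G W) X ∪ W := by
  intro v hv
  obtain ⟨hvX, u, hu, hadj⟩ := mem_bdry.1 hv
  rw [Finset.mem_sdiff] at hu hvX
  rw [Finset.mem_union]
  by_cases hvW : v ∈ W
  · exact Or.inr hvW
  · exact Or.inl (mem_bdry.2 ⟨fun h => hvX ⟨h, hvW⟩, u, hu.1, hadj, hu.2, hvW⟩)

/-- Large sets still expand after deleting few vertices. -/
lemma IsExpander.large_expansion {G : SimpleGraph V} {k : ℝ} {R w₀ : ℕ} (hG : IsExpander G 1 k)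
    (hk : 0 < k) (hR : 0 < R) (hkw : k ≤ w₀)
    (hlog : Real.log (15 * Fintype.card V / k) ≤ 2 * R)
    {W : Finset V} (hW : W.card ≤ w₀) (X : Finset V) (h1 : 16 * R ^ 2 * w₀ ≤ X.card)
    (h2 : 2 * X.card ≤ Fintype.card V) : X.card ≤ 8 * R ^ 2 * (bdry (del G W) X).card := by
  classical
  have hR2 : 1 ≤ R ^ 2 := Nat.one_le_pow _ _ hR
  have hsd : X.card ≤ (X \ W).card + w₀ := by
    have := Finset.card_le_card_sdiff_add_card (s := X) (t := W)
    omega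
  have hle : (X \ W).card ≤ X.card := Finset.card_le_card Finset.sdiff_subset
  have hbig : w₀ ≤ (X \ W).card := by nlinarith
  have hpos : (0 : ℝ) < (X \ W).card := by
    have : (w₀ : ℝ) ≤ (X \ W).card := by exact_mod_cast hbig
    linarith
  have hcard : ((X \ W).card : ℝ) ≤ Fintype.card V := by exact_mod_cast Finset.card_le_univ _
  have h := hG.card_le hk (X := X \ W) (M := 2 * R)
    (by have : (w₀ : ℝ) ≤ (X \ W).card := by exact_mod_cast hbig
        linarith) (by omega) (by
      refine le_trans (Real.log_le_log (by positivity) ?_) hlog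
      gcongr)
  have h' : (X \ W).card ≤ 4 * R ^ 2 * (bdry G (X \ W)).card := by
    have : ((X \ W).card : ℝ) ≤ 4 * R ^ 2 * (bdry G (X \ W)).card := by linarith
    exact_mod_cast this
  have h3 : (bdry G (X \ W)).card ≤ (bdry (del G W) X).card + w₀ :=
    (Finset.card_le_card (bdry_sdiff_subset G W X)).trans
      ((Finset.card_union_le _ _).trans (by omega))
  nlinarith

/-- If `G` has no balanced subdivision `TK_q^(2)`, then few vertices outside `W` have many
neighbours in `W`. -/
lemma card_many_nbrs_le {G : SimpleGraph V} {q : ℕ} (hfree : ¬ ContainsBalSub G q 2)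
    (W B : Finset V) (hB : ∀ v ∈ B, v ∉ W ∧ q ≤ (nbrIn G v W).card) : B.card ≤ W.card ^ 2 := by
  classical
  by_contra! hlt
  let good : Finset V → Prop := fun A => ∃ f : V → Sym2 V, Set.InjOn f A ∧
    ∀ v ∈ A, f v ∈ W.sym2 ∧ ∀ x ∈ f v, G.Adj v x
  obtain ⟨A, hA, hmax⟩ := Finset.exists_max_image (B.powerset.filter good) Finset.card
    ⟨∅, by
      refine Finset.mem_filter.2 ⟨by simp, fun v => s(v, v), by simp, by simp⟩⟩
  rw [Finset.mem_filter, Finset.mem_powerset] at hA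
  obtain ⟨hAB, f, hinj, hf⟩ := hA
  have hAcard : A.card ≤ W.card ^ 2 := by
    have h1 : A.card ≤ W.sym2.card :=
      Finset.card_le_card_of_injOn f (fun v hv => (hf v hv).1) hinj
    rw [Finset.card_sym2, Nat.choose_two_right] at h1
    have h2 : (W.card + 1) * (W.card + 1 - 1) / 2 ≤ W.card ^ 2 := by
      apply Nat.div_le_of_le_mul
      rw [Nat.add_sub_cancel]
      nlinarith [Nat.le_self_pow two_ne_zero W.card]
    exact h1.trans h2
  obtain ⟨v, hvB, hvA⟩ : ∃ v ∈ B, v ∉ A := by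
    by_contra! hcon
    have := Finset.card_le_card (s := B) (t := A) hcon
    omega
  obtain ⟨hvW, hvq⟩ := hB v hvB
  obtain ⟨T, hTsub, hTcard⟩ := Finset.exists_subset_card_eq hvq
  let e := (T.equivFinOfCardEq hTcard).symm
  have he : ∀ i, (e i : V) ∈ W ∧ G.Adj v (e i) := fun i => mem_nbrIn.1 (hTsub (e i).2)
  have hmid : ∀ i j : Fin q, ∃ z ∈ A, f z = s((e i : V), (e j : V)) := by
    intro i j
    by_contra! hcon
    have hmem : insert v A ∈ B.powerset.filter good := by
      refine Finset.mem_filter.2 ⟨Finset.mem_powerset.2 (Finset.insert_subset hvB hAB),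
        Function.update f v s((e i : V), (e j : V)), ?_, ?_⟩
      · intro x hx y hy hxy
        rw [Finset.coe_insert, Set.mem_insert_iff] at hx hy
        rcases hx with rfl | hx <;> rcases hy with rfl | hy
        · rfl
        · have hne : y ≠ x := fun h => hvA (h ▸ hy)
          rw [Function.update_self, Function.update_of_ne hne] at hxy
          exact absurd hxy.symm (hcon y hy)
        · have hne : x ≠ y := fun h => hvA (h ▸ hx)
          rw [Function.update_self, Function.update_of_ne hne] at hxy
          exact absurd hxy (hcon x hx)
        · have hne : x ≠ v := fun h => hvA (h ▸ hx)
          have hne' : y ≠ v := fun h => hvA (h ▸ hy)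
          rw [Function.update_of_ne hne, Function.update_of_ne hne'] at hxy
          exact hinj hx hy hxy
      · intro x hx
        rw [Finset.mem_insert] at hx
        rcases hx with rfl | hx
        · rw [Function.update_self]
          refine ⟨by simp [(he i).1, (he j).1], ?_⟩
          intro y hy
          rw [Sym2.mem_iff] at hy
          rcases hy with rfl | rfl
          · exact (he i).2
          · exact (he j).2
        · have hne : x ≠ v := fun h => hvA (h ▸ hx)
          rw [Function.update_of_ne hne]
          exact hf x hx
    have := hmax _ hmem
    rw [Finset.card_insert_of_notMem hvA] at this
    omega
  choose z hzA hz using hmid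
  have hzW : ∀ i j, z i j ∉ W := fun i j => (hB _ (hAB (hzA i j))).1
  have hzi : ∀ i j, G.Adj (e i) (z i j) := fun i j =>
    ((hf _ (hzA i j)).2 _ (by rw [hz]; simp)).symm
  have hzj : ∀ i j, G.Adj (z i j) (e j) := fun i j => (hf _ (hzA i j)).2 _ (by rw [hz]; simp)
  have heinj : Function.Injective fun i => (e i : V) :=
    Subtype.val_injective.comp e.injective
  refine hfree ⟨fun i => (e i : V), heinj,
    fun i j _ => .cons (hzi i j) (.cons (hzj i j) .nil), ?_, ?_, ?_⟩
  · intro i j hij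
    refine ⟨?_, rfl⟩
    simp only [SimpleGraph.Walk.cons_isPath_iff, SimpleGraph.Walk.IsPath.nil,
      SimpleGraph.Walk.support_cons, SimpleGraph.Walk.support_nil, List.mem_cons,
      List.not_mem_nil, or_false, true_and, not_or]
    exact ⟨(hzj i j).ne, (hzi i j).ne, fun h => hij.ne (heinj h)⟩
  · intro i j hij p hp
    simp only [SimpleGraph.Walk.support_cons, SimpleGraph.Walk.support_nil, List.mem_cons,
      List.not_mem_nil, or_false] at hp
    rcases hp with h | h | h
    · exact Or.inl (heinj h)
    · exact absurd (h ▸ (he p).1) (hzW i j)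
    · exact Or.inr (heinj h)
  · intro i j hij i' j' hij' hne x hx hx'
    simp only [SimpleGraph.Walk.support_cons, SimpleGraph.Walk.support_nil, List.mem_cons,
      List.not_mem_nil, or_false] at hx hx'
    rcases hx with rfl | rfl | rfl
    · rcases hx' with h | h | h
      · exact ⟨Or.inl rfl, Or.inl h⟩
      · exact absurd (h ▸ (he i).1) (hzW i' j')
      · exact ⟨Or.inl rfl, Or.inr h⟩
    · rcases hx' with h | h | h
      · exact absurd (h ▸ (he i').1) (hzW i j)
      · exfalso
        have h3 := hz i j
        rw [h, hz i' j', Sym2.eq_iff] at h3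
        rcases h3 with ⟨h4, h5⟩ | ⟨h4, h5⟩
        · exact hne (Prod.ext (heinj h4).symm (heinj h5).symm)
        · have h4' : i' = j := heinj h4
          have h5' : j' = i := heinj h5
          subst h4' h5'
          exact absurd hij (not_lt.2 hij'.le)
      · exact absurd (h ▸ (he j').1) (hzW i j)
    · rcases hx' with h | h | h
      · exact ⟨Or.inr rfl, Or.inl h⟩
      · exact absurd (h ▸ (he j).1) (hzW i' j')
      · exact ⟨Or.inr rfl, Or.inr h⟩

/-- A subset of average degree at least `2δ` contains a subset of minimum degree at least `δ`. -/
lemma exists_min_degree_subset {G : SimpleGraph V} {δ : ℕ} (S₀ : Finset V)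
    (hne : S₀.Nonempty) (hS₀ : 2 * δ * S₀.card ≤ ∑ v ∈ S₀, (nbrIn G v S₀).card) :
    ∃ S ⊆ S₀, S.Nonempty ∧ ∀ v ∈ S, δ ≤ (nbrIn G v S).card := by
  classical
  obtain ⟨S, hS, hmin⟩ := Finset.exists_min_image
    (S₀.powerset.filter fun S => S.Nonempty ∧ 2 * δ * S.card ≤ ∑ v ∈ S, (nbrIn G v S).card)
    Finset.card ⟨S₀, by simp [hne, hS₀]⟩
  rw [Finset.mem_filter, Finset.mem_powerset] at hS
  obtain ⟨hsub, hSne, hsum⟩ := hS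
  refine ⟨S, hsub, hSne, ?_⟩
  by_contra! hcon
  obtain ⟨v, hv, hlt⟩ := hcon
  have hcard : (S.erase v).card + 1 = S.card := Finset.card_erase_add_one hv
  have hsplit : ∀ u ∈ S.erase v,
      (nbrIn G u S).card = (nbrIn G u (S.erase v)).card + if G.Adj v u then 1 else 0 := by
    intro u _
    unfold nbrIn
    rw [Finset.filter_erase]
    split_ifs with h
    · rw [Finset.card_erase_add_one (Finset.mem_filter.2 ⟨hv, h.symm⟩)]
    · rw [Finset.erase_eq_of_notMem (fun hm => h (Finset.mem_filter.1 hm).2.symm), add_zero]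
  have hdeg : (∑ u ∈ S.erase v, if G.Adj v u then 1 else 0) ≤ (nbrIn G v S).card := by
    rw [← Finset.card_filter]
    exact Finset.card_le_card (Finset.filter_subset_filter _ (Finset.erase_subset _ _))
  have hsum2 : ∑ u ∈ S, (nbrIn G u S).card ≤
      ∑ u ∈ S.erase v, (nbrIn G u (S.erase v)).card + 2 * (nbrIn G v S).card := by
    rw [← Finset.add_sum_erase S _ hv, Finset.sum_congr rfl hsplit, Finset.sum_add_distrib]
    omega
  have hpos : 0 < (S.erase v).card := by
    rcases Nat.eq_zero_or_pos (S.erase v).card with h0 | h0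
    · have h1 : S.erase v = ∅ := Finset.card_eq_zero.1 h0
      rw [h1, Finset.sum_empty] at hsum2
      rw [← hcard, h0] at hsum
      omega
    · exact h0
  have := hmin (S.erase v) (Finset.mem_filter.2 ⟨Finset.mem_powerset.2
    ((Finset.erase_subset _ _).trans hsub), Finset.card_pos.1 hpos, by
      rw [← hcard] at hsum
      nlinarith⟩)
  omega

/-- In a `TK_q^(2)`-free graph of minimum degree `b`, there is a subset of large minimum degree
avoiding any given small set. -/
lemma exists_min_degree_avoiding {G : SimpleGraph V} {q b δ : ℕ}
    (hfree : ¬ ContainsBalSub G q 2) (hdeg : ∀ v, b ≤ (nbrIn G v Finset.univ).card)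
    (hq : 2 * q ≤ b + 1) (hδ : 5 * δ ≤ b + 4) (hb : 40 ≤ b)
    (hV : 0 < Fintype.card V)
    (Z : Finset V) (hZ : 10 * (Z.card + Z.card ^ 2) ≤ Fintype.card V) :
    ∃ S : Finset V, Disjoint S Z ∧ S.Nonempty ∧ ∀ v ∈ S, δ ≤ (nbrIn G v S).card := by
  classical
  set B := Zᶜ.filter fun v => q ≤ (nbrIn G v Z).card with hBdef
  have hB : B.card ≤ Z.card ^ 2 := card_many_nbrs_le hfree Z B fun v hv => by
    rw [hBdef, Finset.mem_filter, Finset.mem_compl] at hv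
    exact hv
  have hZc : Zᶜ.card + Z.card = Fintype.card V := by
    rw [add_comm, Finset.card_add_card_compl]
  have hBsub : B ⊆ Zᶜ := Finset.filter_subset _ _
  have hBc : (Zᶜ \ B).card + B.card = Zᶜ.card := Finset.card_sdiff_add_card_eq_card hBsub
  have hlow : ∀ v ∈ Zᶜ \ B, b ≤ 2 * (nbrIn G v Zᶜ).card := by
    intro v hv
    rw [Finset.mem_sdiff] at hv
    have h1 : (nbrIn G v Z).card < q := by
      by_contra! h
      exact hv.2 (Finset.mem_filter.2 ⟨hv.1, h⟩)
    have h2 : (nbrIn G v Finset.univ).card ≤ (nbrIn G v Zᶜ).card + (nbrIn G v Z).card := by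
      refine le_trans (Finset.card_le_card ?_) (Finset.card_union_le _ _)
      intro u hu
      rw [Finset.mem_union, mem_nbrIn, mem_nbrIn, Finset.mem_compl]
      have := (mem_nbrIn.1 hu).2
      tauto
    have := hdeg v
    omega
  have hsum : (Zᶜ \ B).card * b ≤ 2 * ∑ v ∈ Zᶜ, (nbrIn G v Zᶜ).card := by
    calc (Zᶜ \ B).card * b = ∑ v ∈ Zᶜ \ B, b := by rw [Finset.sum_const, smul_eq_mul]
      _ ≤ ∑ v ∈ Zᶜ \ B, 2 * (nbrIn G v Zᶜ).card := Finset.sum_le_sum hlow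
      _ ≤ ∑ v ∈ Zᶜ, 2 * (nbrIn G v Zᶜ).card :=
        Finset.sum_le_sum_of_subset Finset.sdiff_subset
      _ = _ := by rw [Finset.mul_sum]
  have h9 : 9 * Fintype.card V ≤ 10 * (Zᶜ \ B).card := by omega
  obtain ⟨S, hS, hSne, hSdeg⟩ := exists_min_degree_subset (G := G) (δ := δ) Zᶜ
    (Finset.card_pos.1 (by omega)) (by
      have : Zᶜ.card ≤ Fintype.card V := by omega
      have h10 : 20 * (2 * δ * Zᶜ.card) ≤ 9 * Fintype.card V * b := by
        have : 40 * δ ≤ 9 * b := by omega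
        calc 20 * (2 * δ * Zᶜ.card) = 40 * δ * Zᶜ.card := by ring
          _ ≤ 9 * b * Fintype.card V := Nat.mul_le_mul this ‹_›
          _ = _ := by ring
      have h11 := Nat.mul_le_mul_right b h9
      nlinarith)
  exact ⟨S, Finset.disjoint_left.2 fun v hv => Finset.mem_compl.1 (hS hv), hSne, hSdeg⟩

end

/-- Paths with common end vertices and total length less than `g` coincide. -/
def ShortUniq (Γ : SimpleGraph V) (g : ℕ) : Prop :=
  ∀ ⦃u v : V⦄ (p q : Γ.Walk u v), p.IsPath → q.IsPath → p.length + q.length < g → p = q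

lemma shortUniq_of_cycles {Γ : SimpleGraph V} {g : ℕ}
    (h : ∀ v (c : Γ.Walk v v), c.IsCycle → g ≤ c.length) : ShortUniq Γ g := by
  intro u v p q hp hq hlt
  by_contra hne
  obtain ⟨w, -, -, c, hc, hle⟩ := hp.exists_isCycle_length_le_add_of_ne hq hne
  have := h w c hc
  omega

/-- In a path shorter than half the girth, the last vertex has no neighbour on the path except its
predecessor. -/
lemma ShortUniq.eq_penultimate {Γ : SimpleGraph V} {g : ℕ} (hg : ShortUniq Γ g) {y u z : V}
    {p : Γ.Walk y u} (hp : p.IsPath) (hlen : p.length + 1 < g) (h : Γ.Adj u z)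
    (hz : z ∈ p.support) : z = p.penultimate := by
  classical
  have hq : (h.symm.toWalk).IsPath := SimpleGraph.Walk.IsPath.of_adj h.symm
  have heq := hg (p.dropUntil z hz) h.symm.toWalk (hp.dropUntil hz) hq (by
    have := p.length_dropUntil_le_length hz
    rw [SimpleGraph.Adj.length_toWalk]
    omega)
  apply hp.eq_penultimate_of_mem_edges
  apply p.edges_dropUntil_subset_edges hz
  rw [heq]
  simp [SimpleGraph.Adj.toWalk, Sym2.eq_swap]

open Classical in
/-- End vertices of paths of length `j` from `y` that avoid `X` apart from `y`. -/
noncomputable def level [Fintype V] (Γ : SimpleGraph V) (y : V) (X : Finset V) (j : ℕ) :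
    Finset V :=
  Finset.univ.filter fun u => ∃ p : Γ.Walk y u, p.IsPath ∧ p.length = j ∧
    ∀ x ∈ p.support, x ∈ X → x = y

section
variable [Fintype V]

lemma mem_level {Γ : SimpleGraph V} {y u : V} {X : Finset V} {j : ℕ} :
    u ∈ level Γ y X j ↔ ∃ p : Γ.Walk y u, p.IsPath ∧ p.length = j ∧
      ∀ x ∈ p.support, x ∈ X → x = y := by simp [level]

open Classical in
lemma level_step {Γ : SimpleGraph V} {g δ j : ℕ} {y : V} {C T S : Finset V}
    (hg : ShortUniq Γ g) (hy : y ∈ S) (hS : ∀ u v, Γ.Adj u v → v ∈ S)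
    (hδ : ∀ v ∈ S, δ ≤ (nbrIn Γ v Finset.univ).card)
    (hC0 : (nbrIn Γ y C).card ≤ 2)
    (hC : ∀ z ∈ C, z ≠ y → ∃ q : Γ.Walk y z, 2 * q.length ≤ g ∧ q.IsPath ∧ ∀ x ∈ q.support, x ∈ C)
    (hyT : y ∉ T) (hT : ∀ i, (T ∩ ball Γ y i).card ≤ i) (hj : 2 * (j + 1) < g) :
    (δ - 2) * (level Γ y (C ∪ T) j).card ≤ (level Γ y (C ∪ T) (j + 1)).card + (j + 1) := by
  set X := C ∪ T with hX
  let N : V → Finset V := fun u => Finset.univ.filter fun z => ∃ q : Γ.Walk y z, q.IsPath ∧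
    q.length = j + 1 ∧ q.penultimate = u ∧ ∀ x ∈ q.support, x ∈ X → x = y ∨ (x = z ∧ x ∈ T)
  have hdisj : Set.PairwiseDisjoint (level Γ y X j : Set V) N := by
    intro u _ u' _ hne
    refine Finset.disjoint_left.2 fun z hz hz' => hne ?_
    obtain ⟨q, hq, hql, hqu, -⟩ := (Finset.mem_filter.1 hz).2
    obtain ⟨q', hq', hql', hqu', -⟩ := (Finset.mem_filter.1 hz').2
    have := hg q q' hq hq' (by omega)
    rw [← hqu, ← hqu', this]
  have hsub : (level Γ y X j).biUnion N ⊆ level Γ y X (j + 1) ∪ (T ∩ ball Γ y (j + 1)) := by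
    intro z hz
    obtain ⟨u, -, hz⟩ := Finset.mem_biUnion.1 hz
    obtain ⟨q, hq, hql, -, hqX⟩ := (Finset.mem_filter.1 hz).2
    rw [Finset.mem_union, Finset.mem_inter]
    by_cases hzT : z ∈ T
    · exact Or.inr ⟨hzT, mem_ball.2 ⟨q, hql.le⟩⟩
    · refine Or.inl (mem_level.2 ⟨q, hq, hql, fun x hx hxX => ?_⟩)
      rcases hqX x hx hxX with h | ⟨rfl, h⟩
      · exact h
      · exact absurd h hzT
  have hcard : ∀ u ∈ level Γ y X j, δ - 2 ≤ (N u).card := by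
    intro u hu
    obtain ⟨p, hp, hpl, hpX⟩ := mem_level.1 hu
    have huS : u ∈ S := by
      cases hrev : p.reverse with
      | nil => exact hy
      | cons h _ => exact hS _ _ h.symm
    let E : Finset V := if j = 0 then nbrIn Γ y C else {p.penultimate}
    have hE : E.card ≤ 2 := by
      simp only [E]
      split_ifs
      · exact hC0
      · simp
    have hNE : nbrIn Γ u Finset.univ ⊆ N u ∪ E := by
      intro z hz
      have hadj := (mem_nbrIn.1 hz).2
      rw [Finset.mem_union]
      by_cases hzp : z ∈ p.support
      · right
        have := hg.eq_penultimate hp (by omega) hadj hzp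
        by_cases hj0 : j = 0
        · exfalso
          cases p with
          | nil => exact hadj.ne (by simpa using Eq.symm (List.mem_singleton.1 hzp))
          | cons =>
            rw [SimpleGraph.Walk.length_cons] at hpl
            omega
        · simp [E, hj0, this]
      · by_cases hzC : z ∈ C
        · right
          have hzy : z ≠ y := fun h => hzp (h ▸ p.start_mem_support)
          by_cases hj0 : j = 0
          · have : u = y := (SimpleGraph.Walk.eq_of_length_eq_zero (hpl.trans hj0)).symm
            subst this
            simp only [E, hj0, if_true]
            exact mem_nbrIn.2 ⟨hzC, hadj⟩
          · exfalso
            obtain ⟨q, hql, hq, hqC⟩ := hC z hzC hzy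
            have heq := hg (p.concat hadj) q (hp.concat hzp hadj) hq (by
              rw [SimpleGraph.Walk.length_concat]; omega)
            have huC : u ∈ C := by
              apply hqC
              rw [← heq, SimpleGraph.Walk.support_concat]
              simp
            have huy := hpX u p.end_mem_support (Finset.mem_union_left _ huC)
            subst huy
            rw [(SimpleGraph.Walk.isPath_iff_nil.1 hp).eq_nil, SimpleGraph.Walk.length_nil] at hpl
            exact hj0 hpl.symm
        · left
          refine Finset.mem_filter.2 ⟨Finset.mem_univ _, p.concat hadj, hp.concat hzp hadj,
            by rw [SimpleGraph.Walk.length_concat, hpl], p.penultimate_concat hadj, ?_⟩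
          intro x hx hxX
          rw [SimpleGraph.Walk.support_concat, List.mem_append,
            List.mem_singleton] at hx
          rcases hx with hx | rfl
          · exact Or.inl (hpX x hx hxX)
          · refine Or.inr ⟨rfl, ?_⟩
            rw [hX, Finset.mem_union] at hxX
            exact hxX.resolve_left hzC
    have h1 := hδ u huS
    have h2 := Finset.card_le_card hNE
    have h3 := Finset.card_union_le (N u) E
    omega
  calc (δ - 2) * (level Γ y X j).card = ∑ u ∈ level Γ y X j, (δ - 2) := by
        rw [Finset.sum_const, smul_eq_mul, mul_comm]
    _ ≤ ∑ u ∈ level Γ y X j, (N u).card := Finset.sum_le_sum hcard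
    _ = ((level Γ y X j).biUnion N).card := (Finset.card_biUnion hdisj).symm
    _ ≤ (level Γ y X (j + 1) ∪ (T ∩ ball Γ y (j + 1))).card := Finset.card_le_card hsub
    _ ≤ _ := (Finset.card_union_le _ _).trans (Nat.add_le_add_left (hT _) _)

open Classical in
/-- Moore-type lower bound on the levels around `y`. -/
lemma card_level_ge {Γ : SimpleGraph V} {g δ τ : ℕ} {y : V} {C T S : Finset V}
    (hg : ShortUniq Γ g) (hy : y ∈ S) (hS : ∀ u v, Γ.Adj u v → v ∈ S)
    (hδ : ∀ v ∈ S, δ ≤ (nbrIn Γ v Finset.univ).card)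
    (hC0 : (nbrIn Γ y C).card ≤ 2)
    (hC : ∀ z ∈ C, z ≠ y → ∃ q : Γ.Walk y z, 2 * q.length ≤ g ∧ q.IsPath ∧ ∀ x ∈ q.support, x ∈ C)
    (hyT : y ∉ T) (hT : ∀ i, (T ∩ ball Γ y i).card ≤ i) (hδ5 : 5 ≤ δ) (hτ : 2 * (τ + 1) < g) :
    (δ - 3) * 2 ^ τ ≤ (level Γ y (C ∪ T) (τ + 1)).card := by
  have hstep := fun j (hj : 2 * (j + 1) < g) => level_step hg hy hS hδ hC0 hC hyT hT hj
  induction τ with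
  | zero =>
    have h0 : 1 ≤ (level Γ y (C ∪ T) 0).card := Finset.card_pos.2 ⟨y, mem_level.2
      ⟨.nil, .nil, rfl, by simp⟩⟩
    have h1 := hstep 0 (by omega)
    have h2 := Nat.mul_le_mul_left (δ - 2) h0
    simp only [zero_add, pow_zero, mul_one] at h1 h2 ⊢
    omega
  | succ τ ih =>
    have h1 := ih (by omega)
    have h2 := hstep (τ + 1) (by omega)
    have h3 : τ + 1 + 1 ≤ (level Γ y (C ∪ T) (τ + 1)).card := by
      refine le_trans ?_ h1
      have h4 : τ + 1 < 2 ^ (τ + 1) := Nat.lt_two_pow_self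
      calc τ + 1 + 1 ≤ 2 ^ (τ + 1) := h4
        _ = 2 * 2 ^ τ := by ring
        _ ≤ _ := Nat.mul_le_mul_right _ (by omega)
    have h5 : 3 * (level Γ y (C ∪ T) (τ + 1)).card ≤ (δ - 2) * (level Γ y (C ∪ T) (τ + 1)).card :=
      Nat.mul_le_mul_right _ (by omega)
    rw [pow_succ]
    have : (δ - 3) * (2 ^ τ * 2) = 2 * ((δ - 3) * 2 ^ τ) := by ring
    omega

end

/-- The arcs of a cycle through its base point. -/
lemma exists_arc {Γ : SimpleGraph V} {y : V} {c : Γ.Walk y y} (hc : c.IsCycle) {z : V}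
    (hz : z ∈ c.support) (hzy : z ≠ y) :
    ∃ q : Γ.Walk y z, 2 * q.length ≤ c.length ∧ q.IsPath ∧ (∀ x ∈ q.support, x ∈ c.support) ∧
      (q.length = 1 → z = c.getVert 1 ∨ z = c.getVert (c.length - 1)) := by
  obtain ⟨i, rfl, hi⟩ := SimpleGraph.Walk.mem_support_iff_exists_getVert.1 hz
  have hi0 : i ≠ 0 := fun h => hzy (by rw [h, c.getVert_zero])
  have hil : i ≠ c.length := fun h => hzy (by rw [h, c.getVert_length])
  by_cases hhalf : 2 * i ≤ c.length
  · refine ⟨c.take i, ?_, hc.isPath_take (by omega), ?_, ?_⟩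
    · rw [SimpleGraph.Walk.take_length]; omega
    · intro x hx
      rw [SimpleGraph.Walk.support_take] at hx
      exact List.mem_of_mem_take hx
    · intro h
      rw [SimpleGraph.Walk.take_length] at h
      left; congr 1; omega
  · refine ⟨(c.drop i).reverse, ?_, (hc.isPath_drop (by omega)).reverse, ?_, ?_⟩
    · rw [SimpleGraph.Walk.length_reverse, SimpleGraph.Walk.drop_length]; omega
    · intro x hx
      rw [SimpleGraph.Walk.support_reverse, List.mem_reverse,
        SimpleGraph.Walk.drop_support_eq_support_drop_min] at hx
      exact List.mem_of_mem_drop hx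
    · intro h
      rw [SimpleGraph.Walk.length_reverse, SimpleGraph.Walk.drop_length] at h
      right; congr 1; omega

lemma card_nbrIn_shortest_cycle {Γ : SimpleGraph V} {y : V} {c : Γ.Walk y y} (hc : c.IsCycle)
    (hg : ShortUniq Γ c.length) {C : Finset V} (hC : ∀ x, x ∈ C ↔ x ∈ c.support) :
    (nbrIn Γ y C).card ≤ 2 := by
  classical
  refine (Finset.card_le_card (t := {c.getVert 1, c.getVert (c.length - 1)}) ?_).trans
    Finset.card_le_two
  intro z hz
  obtain ⟨hzC, hadj⟩ := mem_nbrIn.1 hz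
  obtain ⟨q, hq1, hq, -, hq2⟩ := exists_arc hc ((hC z).1 hzC) hadj.ne'
  have h3 := hc.three_le_length
  have heq := hg q hadj.toWalk hq (SimpleGraph.Walk.IsPath.of_adj hadj) (by
    rw [SimpleGraph.Adj.length_toWalk]; omega)
  have := hq2 (by rw [heq, SimpleGraph.Adj.length_toWalk])
  simpa using this

/-- A graph with a nonempty set of vertices of minimum degree at least five has a shortest cycle,
and that cycle has logarithmic length. -/
lemma exists_shortest_cycle [Fintype V] {Γ : SimpleGraph V} {δ a : ℕ} {S : Finset V}
    (hne : S.Nonempty) (hS : ∀ u v, Γ.Adj u v → v ∈ S)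
    (hδ : ∀ v ∈ S, δ ≤ (nbrIn Γ v Finset.univ).card) (hδ5 : 5 ≤ δ)
    (hn : Fintype.card V < 2 ^ a) :
    ∃ (y : V) (c : Γ.Walk y y), c.IsCycle ∧ ShortUniq Γ c.length ∧ c.length < 2 * a + 4 := by
  classical
  have key : ∀ g, ShortUniq Γ g → g < 2 * a + 4 := by
    intro g hg
    by_contra! hge
    obtain ⟨y, hy⟩ := hne
    have h := card_level_ge (C := ∅) (T := ∅) (τ := a) hg hy hS hδ (by simp [nbrIn]) (by simp)
      (by simp) (by simp) hδ5 (by omega)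
    have h2 := Finset.card_le_univ (level Γ y (∅ ∪ ∅) (a + 1))
    have h3 : 1 * 2 ^ a ≤ (δ - 3) * 2 ^ a := Nat.mul_le_mul_right _ (by omega)
    omega
  have hex : ∃ l, ∃ (y : V) (c : Γ.Walk y y), c.IsCycle ∧ c.length = l := by
    by_contra! hcon
    have := key (2 * a + 4) (shortUniq_of_cycles fun v c hc => absurd rfl (hcon _ v c hc))
    omega
  obtain ⟨y, c, hc, hl⟩ := Nat.find_spec hex
  have hu : ShortUniq Γ c.length := shortUniq_of_cycles fun v c' hc' => by
    rw [hl]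
    exact Nat.find_min' hex ⟨v, c', hc', rfl⟩
  exact ⟨y, c, hc, hu, key _ hu⟩

/-- If disjoint families of sets with property `P` are small, then all such sets meet a common small
set. -/
lemma exists_transversal [Fintype V] (P : Finset V → Prop) {D M : ℕ}
    (hne : ∀ X, P X → X.Nonempty) (hD : ∀ X, P X → X.card ≤ D)
    (hM : ∀ F : Finset (Finset V), (∀ X ∈ F, P X) → (F : Set (Finset V)).PairwiseDisjoint id →
      F.card ≤ M) :
    ∃ Y : Finset V, Y.card ≤ M * D ∧ ∀ X, P X → ¬ Disjoint X Y := by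
  classical
  obtain ⟨F, hF, hmax⟩ := Finset.exists_max_image
    ((Finset.univ : Finset (Finset (Finset V))).filter fun F : Finset (Finset V) =>
      (∀ X ∈ F, P X) ∧ (F : Set (Finset V)).PairwiseDisjoint id) Finset.card ⟨∅, by simp⟩
  obtain ⟨hFP, hFd⟩ := (Finset.mem_filter.1 hF).2
  refine ⟨F.biUnion id, ?_, fun X hX hdis => ?_⟩
  · refine (Finset.card_biUnion_le_card_mul F id D fun X hX => hD X (hFP X hX)).trans ?_
    exact Nat.mul_le_mul_right _ (hM F hFP hFd)
  · rw [Finset.disjoint_biUnion_right] at hdis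
    have hXF : X ∉ F := fun h => by
      have := hdis X h
      rw [id, Finset.disjoint_self_iff_empty] at this
      exact (hne X hX).ne_empty this
    have := hmax (insert X F) (Finset.mem_filter.2 ⟨Finset.mem_univ _, by
        simpa using ⟨hX, hFP⟩, by
        rw [Finset.coe_insert]
        exact hFd.insert fun Y hY _ => hdis Y hY⟩)
    rw [Finset.card_insert_of_notMem hXF] at this
    omega

lemma card_powerset_filter_le (W : Finset V) (t w : ℕ) (hw : W.card ≤ w) :
    (W.powerset.filter fun T => T.card ≤ t).card ≤ (t + 1) * (w + 1) ^ t := by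
  classical
  have hsub : (W.powerset.filter fun T => T.card ≤ t) ⊆
      (Finset.range (t + 1)).biUnion fun i => W.powersetCard i := by
    intro T hT
    rw [Finset.mem_filter, Finset.mem_powerset] at hT
    rw [Finset.mem_biUnion]
    exact ⟨T.card, Finset.mem_range.2 (by omega), Finset.mem_powersetCard.2 ⟨hT.1, rfl⟩⟩
  refine (Finset.card_le_card hsub).trans ?_
  refine (Finset.card_biUnion_le_card_mul _ _ ((w + 1) ^ t) fun i hi => ?_).trans (by simp)
  rw [Finset.card_powersetCard]
  calc W.card.choose i ≤ W.card ^ i := Nat.choose_le_pow _ _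
    _ ≤ (w + 1) ^ i := Nat.pow_le_pow_left (by omega) _
    _ ≤ (w + 1) ^ t := Nat.pow_le_pow_right (by omega) (by
      have := Finset.mem_range.1 hi; omega)

open Classical in
/-- The vertices of `W` with a neighbour in `X`. -/
noncomputable def trace (G : SimpleGraph V) (W X : Finset V) : Finset V :=
  W.filter fun v => ∃ u ∈ X, G.Adj u v

open Classical in
lemma card_trace_le {G : SimpleGraph V} {W X : Finset V} {b : ℕ}
    (h : ∀ v ∈ X, (nbrIn G v W).card ≤ b) : (trace G W X).card ≤ X.card * b := by
  have hsub : trace G W X ⊆ X.biUnion fun v => nbrIn G v W := by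
    intro u hu
    obtain ⟨huW, v, hv, hadj⟩ := Finset.mem_filter.1 hu
    exact Finset.mem_biUnion.2 ⟨v, hv, mem_nbrIn.2 ⟨huW, hadj⟩⟩
  exact (Finset.card_le_card hsub).trans (Finset.card_biUnion_le_card_mul _ _ _ h)

section
variable [Fintype V]

open Classical in
lemma bdry_biUnion_subset (G : SimpleGraph V) (W : Finset V) (F : Finset (Finset V))
    (hFW : ∀ X ∈ F, Disjoint X W) :
    bdry G (F.biUnion id) ⊆ F.biUnion (fun X => trace G W X) ∪
      F.biUnion fun X => bdry (del G W) X := by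
  intro v hv
  obtain ⟨hvU, u, hu, hadj⟩ := mem_bdry.1 hv
  obtain ⟨X, hX, huX⟩ := Finset.mem_biUnion.1 hu
  rw [Finset.mem_union, Finset.mem_biUnion, Finset.mem_biUnion]
  by_cases hvW : v ∈ W
  · exact Or.inl ⟨X, hX, Finset.mem_filter.2 ⟨hvW, u, huX, hadj⟩⟩
  · refine Or.inr ⟨X, hX, mem_bdry.2 ⟨fun h => hvU (Finset.mem_biUnion.2 ⟨X, hX, h⟩), u, huX,
      hadj, fun h => Finset.disjoint_left.1 (hFW X hX) huX h, hvW⟩⟩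

/-- Few disjoint sets of medium size can fail to expand after deleting `W`. -/
lemma card_medium_poor_le {G : SimpleGraph V} {k : ℝ} {w₀ D L : ℕ} (hG : IsExpander G 1 k)
    (hk : 0 < k) (hw0 : 1 ≤ w₀) (hL : 1 ≤ L)
    (hlog : 2 * Real.log (15 * (w₀ * D : ℕ) / k) ^ 2 < L)
    (hn : 2 * (w₀ * D) ≤ Fintype.card V) {W : Finset V} (hW : W.card ≤ w₀)
    {F : Finset (Finset V)} (hF : ∀ X ∈ F, Disjoint X W ∧ k / 2 ≤ X.card ∧ X.card ≤ D ∧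
      L ^ 4 < X.card ∧ ¬ X.card ≤ L * (bdry (del G W) X).card)
    (hd : (F : Set (Finset V)).PairwiseDisjoint id) : F.card ≤ w₀ := by
  classical
  by_contra! hlt
  obtain ⟨F', hF'F, hF'⟩ := Finset.exists_subset_card_eq hlt.le
  replace hF : ∀ X ∈ F', _ := fun X hX => hF X (hF'F hX)
  replace hd : (F' : Set (Finset V)).PairwiseDisjoint id :=
    hd.subset (Finset.coe_subset.2 hF'F)
  set U := F'.biUnion id with hU
  have hUcard : U.card = ∑ X ∈ F', X.card := Finset.card_biUnion hd
  have hUle : U.card ≤ w₀ * D := by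
    rw [hUcard, ← hF', ← smul_eq_mul]
    exact Finset.sum_le_card_nsmul _ _ _ fun X hX => (hF X hX).2.2.1
  have hUge : w₀ * L ^ 4 ≤ U.card := by
    rw [hUcard, ← hF', ← smul_eq_mul]
    exact Finset.card_nsmul_le_sum _ _ _ fun X hX => (hF X hX).2.2.2.1.le
  have hb : (bdry G U).card ≤ w₀ + ∑ X ∈ F', (bdry (del G W) X).card := by
    refine (Finset.card_le_card (bdry_biUnion_subset G W F' fun X hX => (hF X hX).1)).trans ?_
    refine (Finset.card_union_le _ _).trans (Nat.add_le_add ?_ Finset.card_biUnion_le)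
    refine le_trans (Finset.card_le_card ?_) hW
    exact Finset.biUnion_subset.2 fun X _ => Finset.filter_subset _ _
  have hsum : L * ∑ X ∈ F', (bdry (del G W) X).card ≤ U.card := by
    rw [Finset.mul_sum, hUcard]
    exact Finset.sum_le_sum fun X hX => by have := (hF X hX).2.2.2.2; omega
  have hL4 : L ≤ L ^ 4 := Nat.le_self_pow (by norm_num) L
  have h2 : L * (bdry G U).card ≤ 2 * U.card := by nlinarith
  obtain ⟨X, hX⟩ : F'.Nonempty := Finset.card_pos.1 (by omega)
  have hXU : X.card ≤ U.card :=
    Finset.card_le_card (Finset.subset_biUnion_of_mem id hX)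
  have hkU : k / 2 ≤ U.card := (hF X hX).2.1.trans (by exact_mod_cast hXU)
  have hUpos : (0 : ℝ) < U.card := lt_of_lt_of_le (by positivity) hkU
  have hex := hG.card_le hk hkU (by omega) (M := Real.log (15 * (w₀ * D : ℕ) / k)) (by
    apply Real.log_le_log (by positivity)
    gcongr)
  set M := Real.log (15 * (w₀ * D : ℕ) / k)
  have h2' : (L : ℝ) * (bdry G U).card ≤ 2 * U.card := by exact_mod_cast h2
  have h3 : (L : ℝ) * U.card ≤ 2 * M ^ 2 * U.card := by
    calc (L : ℝ) * U.card ≤ L * (M ^ 2 * (bdry G U).card) := by gcongr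
      _ = M ^ 2 * (L * (bdry G U).card) := by ring
      _ ≤ M ^ 2 * (2 * U.card) := by gcongr
      _ = _ := by ring
  have h4 := le_of_mul_le_mul_right h3 hUpos
  linarith

/-- Few disjoint sets of small size can fail to expand after deleting `W`. -/
lemma card_small_poor_le {G : SimpleGraph V} {k : ℝ} {w₀ b t : ℕ} (hG : IsExpander G 1 k)
    (hk : 0 < k) (hb0 : 1 ≤ b)
    (hlog : ∀ x e : ℕ, k / 2 ≤ x → e ^ 4 < x ^ 3 →
      Real.log (15 * (b * x ^ 2 : ℕ) / k) ^ 2 * (1 + e) < x)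
    (hn : 2 * (b * t ^ 2) ≤ Fintype.card V) {W : Finset V} (hW : W.card ≤ w₀)
    {F : Finset (Finset V)} (hF : ∀ X ∈ F, Disjoint X W ∧ k / 2 ≤ X.card ∧ X.card ≤ t ∧
      (∀ v ∈ X, (nbrIn G v W).card ≤ b) ∧ (bdry (del G W) X).card ^ 4 < X.card ^ 3)
    (hd : (F : Set (Finset V)).PairwiseDisjoint id) :
    F.card ≤ (b * t) * ((t + 1) * ((t * b + 1) * (w₀ + 1) ^ (t * b))) := by
  classical
  have hmaps : Set.MapsTo (fun X : Finset V => (X.card, trace G W X)) F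
      ((Finset.range (t + 1)) ×ˢ (W.powerset.filter fun T => T.card ≤ t * b) :
        Finset (ℕ × Finset V)) := by
    intro X hX
    obtain ⟨-, -, h1, h2, -⟩ := hF X hX
    rw [Finset.mem_coe, Finset.mem_product, Finset.mem_range, Finset.mem_filter,
      Finset.mem_powerset]
    exact ⟨by simp only; omega, Finset.filter_subset _ _,
      (card_trace_le h2).trans (Nat.mul_le_mul_right _ h1)⟩
  have hfib : ∀ p ∈ ((Finset.range (t + 1)) ×ˢ (W.powerset.filter fun T => T.card ≤ t * b) :
        Finset (ℕ × Finset V)),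
      (F.filter fun X => (X.card, trace G W X) = p).card ≤ b * t := by
    rintro ⟨x, T⟩ hp
    by_contra! hlt
    rw [Finset.mem_product, Finset.mem_range] at hp
    have hxt : x ≤ t := by have := hp.1; simp only at this; omega
    obtain ⟨F', hF'F, hF'⟩ := Finset.exists_subset_card_eq
      ((Nat.mul_le_mul_left b hxt).trans hlt.le)
    have hF'' : ∀ X ∈ F', X.card = x ∧ trace G W X = T := fun X hX => by
      have := (Finset.mem_filter.1 (hF'F hX)).2
      simpa using this
    have hF₀ := hF
    replace hF : ∀ X ∈ F', _ := fun X hX => hF X (Finset.mem_filter.1 (hF'F hX)).1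
    replace hd : (F' : Set (Finset V)).PairwiseDisjoint id :=
      hd.subset (fun X hX => (Finset.mem_filter.1 (hF'F hX)).1)
    set U := F'.biUnion id with hU
    have hUcard : U.card = b * x ^ 2 := by
      rw [hU, Finset.card_biUnion hd, Finset.sum_congr rfl
        fun X hX => (show (id X).card = x from (hF'' X hX).1),
        Finset.sum_const, hF', smul_eq_mul]
      ring
    obtain ⟨X₀, hX₀⟩ : (F.filter fun X => (X.card, trace G W X) = (x, T)).Nonempty :=
      Finset.card_pos.1 (by omega)
    have hx : k / 2 ≤ x := by
      rw [Finset.mem_filter] at hX₀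
      have h1 := (hF₀ X₀ hX₀.1).2.1
      have h2 : X₀.card = x := (Prod.ext_iff.1 hX₀.2).1
      rwa [h2] at h1
    have hxpos : 0 < x := by
      have : (0 : ℝ) < x := lt_of_lt_of_le (by positivity) hx
      exact_mod_cast this
    obtain ⟨X₁, hX₁⟩ : F'.Nonempty := Finset.card_pos.1 (by rw [hF']; positivity)
    have hTcard : T.card ≤ x * b := by
      rw [← (hF'' X₁ hX₁).2, ← (hF'' X₁ hX₁).1]
      exact card_trace_le (hF X₁ hX₁).2.2.2.1
    obtain ⟨Xm, hXm, hmax⟩ := Finset.exists_max_image F' (fun X => (bdry (del G W) X).card)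
      ⟨X₁, hX₁⟩
    set e := (bdry (del G W) Xm).card with he
    have he4 : e ^ 4 < x ^ 3 := by
      have := (hF Xm hXm).2.2.2.2
      rwa [(hF'' Xm hXm).1] at this
    have hb : (bdry G U).card ≤ x * b + b * x * e := by
      refine (Finset.card_le_card (bdry_biUnion_subset G W F' fun X hX => (hF X hX).1)).trans ?_
      refine (Finset.card_union_le _ _).trans (Nat.add_le_add ?_ ?_)
      · refine le_trans (Finset.card_le_card ?_) hTcard
        exact Finset.biUnion_subset.2 fun X hX => by rw [(hF'' X hX).2]
      · exact (Finset.card_biUnion_le_card_mul _ _ e hmax).trans (by rw [hF'])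
    have hxU : x ≤ U.card := by
      rw [hUcard]
      nlinarith [Nat.le_self_pow two_ne_zero x]
    have hUn : 2 * U.card ≤ Fintype.card V := by
      rw [hUcard]
      refine le_trans ?_ hn
      gcongr
    have hex := hG.card_le hk (X := U) (hx.trans (by exact_mod_cast hxU)) hUn (by
      rw [hUcard])
    set M := Real.log (15 * (b * x ^ 2 : ℕ) / k)
    have h1 := hlog x e hx he4
    have hb' : ((bdry G U).card : ℝ) ≤ x * b + b * x * e := by exact_mod_cast hb
    rw [hUcard] at hex
    push_cast at hex
    have hbx : (0 : ℝ) < b * x := by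
      have : (0 : ℝ) < b := by exact_mod_cast hb0
      have : (0 : ℝ) < x := by exact_mod_cast hxpos
      positivity
    have h2 : (b * x : ℝ) * x ≤ (b * x) * (M ^ 2 * (1 + e)) := by
      calc (b * x : ℝ) * x = b * x ^ 2 := by ring
        _ ≤ M ^ 2 * (bdry G U).card := hex
        _ ≤ M ^ 2 * (x * b + b * x * e) := by gcongr
        _ = _ := by ring
    have h3 := le_of_mul_le_mul_left h2 hbx
    linarith
  refine (Finset.card_le_mul_card_image_of_maps_to hmaps _ hfib).trans ?_
  rw [Finset.card_product, Finset.card_range]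
  gcongr
  exact card_powerset_filter_le W _ _ hW

open Classical in
/-- After deleting a small set `W`, all sets of at most `D` vertices outside a small exceptional
set expand well. -/
lemma exists_exceptional_set {G : SimpleGraph V} {k : ℝ} {w₀ D L q b B : ℕ}
    (hG : IsExpander G 1 k) (hk : 0 < k) (hw0 : 1 ≤ w₀) (hL : 1 ≤ L) (hb0 : 1 ≤ b)
    (hqb : q ≤ b + 1) (hfree : ¬ ContainsBalSub G q 2)
    (hlog : 2 * Real.log (15 * (w₀ * D : ℕ) / k) ^ 2 < L)
    (hlog' : ∀ x e : ℕ, k / 2 ≤ x → e ^ 4 < x ^ 3 →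
      Real.log (15 * (b * x ^ 2 : ℕ) / k) ^ 2 * (1 + e) < x)
    (hn : 2 * (w₀ * D) ≤ Fintype.card V) (hn' : 2 * (b * (L ^ 4) ^ 2) ≤ Fintype.card V)
    (hB : k / 2 ≤ (L : ℝ) ^ 4 →
      (b * L ^ 4) * ((L ^ 4 + 1) * ((L ^ 4 * b + 1) * (w₀ + 1) ^ (L ^ 4 * b))) ≤ B)
    {W : Finset V} (hW : W.card ≤ w₀) :
    ∃ Y : Finset V, Y.card ≤ w₀ ^ 2 + (w₀ + B) * D ∧ ∀ X : Finset V, Disjoint X W →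
      Disjoint X Y → k / 2 ≤ X.card → X.card ≤ D →
        X.card ^ 3 ≤ (bdry (del G W) X).card ^ 4 ∧ X.card ≤ L * (bdry (del G W) X).card := by
  set W₂ := Wᶜ.filter fun v => q ≤ (nbrIn G v W).card with hW₂
  have hW₂card : W₂.card ≤ w₀ ^ 2 := by
    refine (card_many_nbrs_le hfree W W₂ fun v hv => ?_).trans (Nat.pow_le_pow_left hW 2)
    rwa [hW₂, Finset.mem_filter, Finset.mem_compl] at hv
  let P : Finset V → Prop := fun X => Disjoint X W ∧ Disjoint X W₂ ∧ k / 2 ≤ X.card ∧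
    X.card ≤ D ∧ ¬ (X.card ^ 3 ≤ (bdry (del G W) X).card ^ 4 ∧
      X.card ≤ L * (bdry (del G W) X).card)
  obtain ⟨Y, hYcard, hY⟩ := exists_transversal P (D := D) (M := w₀ + B)
    (fun X hX => by
      have h1 : (0 : ℝ) < X.card := lt_of_lt_of_le (by positivity) hX.2.2.1
      exact Finset.card_pos.1 (by exact_mod_cast h1))
    (fun X hX => hX.2.2.2.1) (by
      intro F hF hd
      have hmed : (F.filter fun X => L ^ 4 < X.card).card ≤ w₀ := by
        refine card_medium_poor_le hG hk hw0 hL hlog hn hW (fun X hX => ?_)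
          (hd.subset (Finset.coe_subset.2 (Finset.filter_subset _ _)))
        obtain ⟨hXF, hXL⟩ := Finset.mem_filter.1 hX
        obtain ⟨h1, -, h3, h4, h5⟩ := hF X hXF
        refine ⟨h1, h3, h4, hXL, fun hle => h5 ⟨?_, hle⟩⟩
        by_contra! hlt
        set e := (bdry (del G W) X).card
        have h6 : X.card ^ 4 ≤ L ^ 4 * e ^ 4 := by
          rw [← mul_pow]; exact Nat.pow_le_pow_left hle 4
        have h7 : X.card * X.card ^ 3 ≤ L ^ 4 * X.card ^ 3 := by
          calc X.card * X.card ^ 3 = X.card ^ 4 := by ring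
            _ ≤ L ^ 4 * e ^ 4 := h6
            _ ≤ _ := Nat.mul_le_mul_left _ hlt.le
        have := Nat.le_of_mul_le_mul_right h7 (lt_of_le_of_lt (Nat.zero_le _) hlt)
        omega
      have hsm : (F.filter fun X => ¬ L ^ 4 < X.card).card ≤ B := by
        rcases Finset.eq_empty_or_nonempty (F.filter fun X => ¬ L ^ 4 < X.card) with h | ⟨X₀, hX₀⟩
        · rw [h]; simp
        · have hkL : k / 2 ≤ (L : ℝ) ^ 4 := by
            obtain ⟨h1, h2⟩ := Finset.mem_filter.1 hX₀
            refine (hF X₀ h1).2.2.1.trans ?_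
            exact_mod_cast not_lt.1 h2
          refine le_trans ?_ (hB hkL)
          refine card_small_poor_le hG hk hb0 hlog' hn' hW (fun X hX => ?_)
            (hd.subset (Finset.coe_subset.2 (Finset.filter_subset _ _)))
          obtain ⟨hXF, hXL⟩ := Finset.mem_filter.1 hX
          obtain ⟨h1, h2, h3, h4, h5⟩ := hF X hXF
          refine ⟨h1, h3, not_lt.1 hXL, fun v hv => ?_, ?_⟩
          · by_contra! hlt
            exact Finset.disjoint_left.1 h2 hv (Finset.mem_filter.2
              ⟨Finset.mem_compl.2 (Finset.disjoint_left.1 h1 hv), by omega⟩)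
          · by_contra! hge
            refine h5 ⟨hge, ?_⟩
            by_contra! hlt
            set e := (bdry (del G W) X).card
            have h6 : L ^ 4 * e ^ 4 < X.card ^ 4 := by
              rw [← mul_pow]; exact Nat.pow_lt_pow_left hlt (by norm_num)
            have h7 : L ^ 4 * X.card ^ 3 < X.card * X.card ^ 3 := by
              calc L ^ 4 * X.card ^ 3 ≤ L ^ 4 * e ^ 4 := Nat.mul_le_mul_left _ hge
                _ < X.card ^ 4 := h6
                _ = _ := by ring
            exact hXL (lt_of_mul_lt_mul_right h7 (Nat.zero_le _))
      rw [← Finset.card_filter_add_card_filter_not (s := F) (fun X => L ^ 4 < X.card)]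
      omega)
  refine ⟨W₂ ∪ Y, (Finset.card_union_le _ _).trans (by omega), fun X h1 h2 h3 h4 => ?_⟩
  rw [Finset.disjoint_union_right] at h2
  by_contra hcon
  exact hY X ⟨h1, h2.1, h3, h4, hcon⟩ h2.2

end

lemma exists_walk_del {G Γ : SimpleGraph V} (hle : Γ ≤ G) {W : Finset V} {u v : V}
    (p : Γ.Walk u v) (h : ∀ x ∈ p.support, x ∉ W) :
    ∃ q : (del G W).Walk u v, q.length = p.length := by
  induction p with
  | nil => exact ⟨.nil, rfl⟩
  | cons hadj p ih =>
    obtain ⟨q, hq⟩ := ih fun x hx => h x (List.mem_cons_of_mem _ hx)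
    have h1 := h _ (SimpleGraph.Walk.start_mem_support _)
    have h2 := h _ (List.mem_cons_of_mem _ p.start_mem_support)
    exact ⟨.cons ⟨hle hadj, h1, h2⟩ q, congrArg (· + 1) hq⟩

lemma isPath_append {G : SimpleGraph V} {u v w : V} {p : G.Walk u v} {q : G.Walk v w}
    (hp : p.IsPath) (hq : q.IsPath) (h : ∀ x ∈ p.support, x ∈ q.support → x = v) :
    (p.append q).IsPath := by
  induction p with
  | nil => simpa using hq
  | cons hadj p ih =>
    rw [SimpleGraph.Walk.cons_isPath_iff] at hp
    rw [SimpleGraph.Walk.cons_append, SimpleGraph.Walk.cons_isPath_iff]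
    refine ⟨ih hp.1 hq fun x hx => h x (List.mem_cons_of_mem _ hx), fun hmem => ?_⟩
    rw [SimpleGraph.Walk.mem_support_append_iff] at hmem
    rcases hmem with hm | hm
    · exact hp.2 hm
    · have := h _ (by simp) hm
      subst this
      exact hp.2 p.end_mem_support

lemma walk_parity {G : SimpleGraph V} {f : V → Bool} (hf : ∀ u v, G.Adj u v → f u ≠ f v) {u v : V}
    (p : G.Walk u v) : Even p.length ↔ f u = f v := by
  induction p with
  | nil => simp
  | cons hadj p ih =>
    rw [SimpleGraph.Walk.length_cons, Nat.even_add_one, ih]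
    have := hf _ _ hadj
    revert this
    cases f _ <;> cases f _ <;> cases f _ <;> simp

section
variable [Fintype V]

open Classical in
/-- The vertices that reach `Y` within `j` steps through vertices of degree less than `D`
(counting the start only when it is in `Y`). -/
noncomputable def spread (G : SimpleGraph V) (D : ℕ) (Y : Finset V) : ℕ → Finset V
  | 0 => Y
  | j + 1 => spread G D Y j ∪ Finset.univ.filter fun v =>
      ∃ u ∈ spread G D Y j, (nbrIn G u Finset.univ).card < D ∧ G.Adj u v

lemma spread_mono (G : SimpleGraph V) (D : ℕ) (Y : Finset V) : Monotone (spread G D Y) := by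
  classical
  refine monotone_nat_of_le_succ fun j => ?_
  rw [spread]
  exact Finset.subset_union_left

lemma card_spread_le (G : SimpleGraph V) (D : ℕ) (Y : Finset V) (j : ℕ) :
    (spread G D Y j).card ≤ Y.card * (1 + D) ^ j := by
  classical
  induction j with
  | zero => simp [spread]
  | succ j ih =>
    rw [spread]
    have hsub : (Finset.univ.filter fun v =>
        ∃ u ∈ spread G D Y j, (nbrIn G u Finset.univ).card < D ∧ G.Adj u v) ⊆
        ((spread G D Y j).filter fun u => (nbrIn G u Finset.univ).card < D).biUnion
          fun u => nbrIn G u Finset.univ := by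
      intro v hv
      obtain ⟨u, hu, h1, h2⟩ := (Finset.mem_filter.1 hv).2
      exact Finset.mem_biUnion.2 ⟨u, Finset.mem_filter.2 ⟨hu, h1⟩,
        mem_nbrIn.2 ⟨Finset.mem_univ _, h2⟩⟩
    have h1 := Finset.card_le_card hsub
    have h2 := Finset.card_biUnion_le_card_mul
      ((spread G D Y j).filter fun u => (nbrIn G u Finset.univ).card < D)
      (fun u => nbrIn G u Finset.univ) D fun u hu => (Finset.mem_filter.1 hu).2.le
    have h3 : ((spread G D Y j).filter fun u => (nbrIn G u Finset.univ).card < D).card ≤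
      (spread G D Y j).card := Finset.card_filter_le _ _
    have h4 := Finset.card_union_le (spread G D Y j) (Finset.univ.filter fun v =>
        ∃ u ∈ spread G D Y j, (nbrIn G u Finset.univ).card < D ∧ G.Adj u v)
    calc _ ≤ (spread G D Y j).card + (spread G D Y j).card * D :=
          h4.trans (Nat.add_le_add_left (h1.trans (h2.trans (Nat.mul_le_mul_right _ h3))) _)
      _ = (spread G D Y j).card * (1 + D) := by ring
      _ ≤ Y.card * (1 + D) ^ j * (1 + D) := Nat.mul_le_mul_right _ ih
      _ = _ := by ring

lemma mem_spread_of_walk {G : SimpleGraph V} {D : ℕ} {Y : Finset V} {y a : V} (p : G.Walk y a)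
    (ha : a ∈ Y) (h : ∀ x ∈ p.support, (nbrIn G x Finset.univ).card < D) :
    y ∈ spread G D Y p.length := by
  classical
  induction p with
  | nil => exact ha
  | cons hadj p ih =>
    have := ih ha fun x hx => h x (List.mem_cons_of_mem _ hx)
    rw [SimpleGraph.Walk.length_cons, spread, Finset.mem_union]
    exact Or.inr (Finset.mem_filter.2 ⟨Finset.mem_univ _, _, this,
      h _ (List.mem_cons_of_mem _ p.start_mem_support), hadj.symm⟩)

open Classical in
lemma card_bdry_le_del_union {G : SimpleGraph V} {W Q : Finset V} {y : V} (hyW : y ∉ W)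
    (hyQ : y ∉ Q) (i : ℕ) :
    (bdry (del G W) (ball (del G (W ∪ Q)) y i)).card ≤
      (bdry (del G (W ∪ Q)) (ball (del G (W ∪ Q)) y i)).card +
        (Q ∩ ball (del G W) y (i + 1)).card := by
  refine le_trans (Finset.card_le_card ?_) (Finset.card_union_le _ _)
  intro v hv
  obtain ⟨hvX, u, hu, hadj⟩ := mem_bdry.1 hv
  have huWQ : u ∉ W ∪ Q := Finset.disjoint_left.1
    (ball_del_disjoint (by rw [Finset.mem_union]; tauto) i) hu
  rw [Finset.mem_union, Finset.mem_inter]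
  by_cases hvQ : v ∈ Q
  · exact Or.inr ⟨hvQ, adj_mem_ball
      (ball_mono_graph (del_anti G Finset.subset_union_left) y i hu) hadj⟩
  · refine Or.inl (mem_bdry.2 ⟨hvX, u, hu, hadj.1, huWQ, ?_⟩)
    rw [Finset.mem_union]
    exact fun h => h.elim hadj.2.2 hvQ

open Classical in
/-- A ball of moderate size around `y` avoiding `Q` keeps growing until it has size `D`, provided
that small sets away from `Y` expand and `y` cannot reach `Y` through low-degree vertices. -/
lemma ball_growth {G : SimpleGraph V} {W Y Q : Finset V} {y : V} {D D₂ L k₀ g τ A m : ℕ}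
    (hgood : ∀ X : Finset V, Disjoint X W → Disjoint X Y → k₀ ≤ X.card → X.card ≤ D →
      X.card ^ 3 ≤ (bdry (del G W) X).card ^ 4 ∧ X.card ≤ L * (bdry (del G W) X).card)
    (hyW : y ∉ W) (hyQ : y ∉ Q) (hQ : ∀ i, (Q ∩ ball (del G W) y i).card ≤ g + i)
    (hD₂ : D + W.card + Q.card ≤ D₂) (hy : y ∉ spread G D₂ Y m)
    (hA : 36 ≤ A) (hgA : g ≤ A) (hτA : τ + 1 ≤ A)
    (h0 : A ^ 2 ≤ (ball (del G (W ∪ Q)) y τ).card)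
    (hk₀ : k₀ ≤ (ball (del G (W ∪ Q)) y τ).card)
    (hm : τ + 2 * L * L + 1 ≤ m) (hL : 1 ≤ L) (hDL : D ≤ 2 ^ L) :
    D ≤ (ball (del G (W ∪ Q)) y m).card := by
  by_contra! hlt
  set H' := del G (W ∪ Q) with hH'
  have hyWQ : y ∉ W ∪ Q := by rw [Finset.mem_union]; tauto
  have hmono : Monotone fun i => (ball H' y i).card := fun i j hij =>
    Finset.card_le_card (ball_mono H' y hij)
  have hlow : ∀ i, i + 1 ≤ m → ∀ u ∈ ball H' y i, (nbrIn G u Finset.univ).card < D₂ := by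
    intro i hi u hu
    by_contra! hge
    have hsub : nbrIn G u Finset.univ \ (W ∪ Q) ⊆ ball H' y (i + 1) := by
      intro w hw
      rw [Finset.mem_sdiff, mem_nbrIn] at hw
      exact adj_mem_ball hu
        ⟨hw.1.2, Finset.disjoint_left.1 (ball_del_disjoint hyWQ i) hu, hw.2⟩
    have h1 := Finset.card_le_card hsub
    have h2 : (ball H' y (i + 1)).card ≤ (ball H' y m).card := hmono hi
    have h3 := Finset.le_card_sdiff (W ∪ Q) (nbrIn G u Finset.univ)
    have h4 := Finset.card_union_le W Q
    omega
  have hdisY : ∀ i, i + 1 ≤ m → Disjoint (ball H' y i) Y := by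
    intro i hi
    rw [Finset.disjoint_left]
    intro a ha haY
    obtain ⟨p, hp⟩ := mem_ball.1 ha
    apply hy
    refine spread_mono G D₂ Y (?_ : (p.mapLe (del_le G (W ∪ Q))).length ≤ m)
      (mem_spread_of_walk _ haY ?_)
    · rw [SimpleGraph.Walk.length_mapLe]; omega
    · intro x hx
      rw [SimpleGraph.Walk.support_mapLe_eq_support] at hx
      exact hlow i hi x (ball_mono H' y hp (support_subset_ball p hx))
  have hdisW : ∀ i, Disjoint (ball H' y i) W := fun i =>
    Finset.disjoint_of_subset_right Finset.subset_union_left (ball_del_disjoint hyWQ i)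
  have key : ∀ i < 2 * L * L, (A + i) ^ 2 ≤ (ball H' y (τ + i)).card →
      (2 * L + 1) * (ball H' y (τ + i)).card ≤ 2 * L * (ball H' y (τ + i + 1)).card ∧
      (A + (i + 1)) ^ 2 ≤ (ball H' y (τ + i + 1)).card := by
    intro i hi hinv
    have hle : (ball H' y (τ + i)).card ≤ (ball H' y m).card := hmono (by omega)
    obtain ⟨h1, h2⟩ := hgood (ball H' y (τ + i)) (hdisW _) (hdisY _ (by omega))
      (hk₀.trans (hmono (by omega))) (by omega)
    set e := (bdry (del G W) (ball H' y (τ + i))).card with he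
    have h3 : 6 * (A + i) ≤ e := by
      by_contra! hcon
      have h4 : e ^ 4 < (6 * (A + i)) ^ 4 := Nat.pow_lt_pow_left hcon (by norm_num)
      have h5 : ((A + i) ^ 2) ^ 3 ≤ (ball H' y (τ + i)).card ^ 3 := Nat.pow_le_pow_left hinv 3
      have h6 : 1296 ≤ (A + i) ^ 2 := by nlinarith
      have h7 : (6 * (A + i)) ^ 4 ≤ ((A + i) ^ 2) ^ 3 := by
        calc (6 * (A + i)) ^ 4 = 1296 * (A + i) ^ 4 := by ring
          _ ≤ (A + i) ^ 2 * (A + i) ^ 4 := Nat.mul_le_mul_right _ h6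
          _ = _ := by ring
      omega
    have h4 := card_bdry_le_del_union hyW hyQ (G := G) (τ + i)
    have h5 := hQ (τ + i + 1)
    have h6 := card_ball_add_card_bdry_le H' y (τ + i)
    have h7 : 2 * (ball H' y (τ + i)).card + e ≤ 2 * (ball H' y (τ + i + 1)).card := by
      rw [← he, ← hH'] at h4
      omega
    constructor
    · nlinarith
    · nlinarith
  have hinv : ∀ i ≤ 2 * L * L, (A + i) ^ 2 ≤ (ball H' y (τ + i)).card := by
    intro i
    induction i with
    | zero => simpa using h0
    | succ i ih => exact fun hi => (key i (by omega) (ih (by omega))).2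
  have := growth_exceeds (f := fun i => (ball H' y (τ + i)).card) (η := 2 * L) (a := L) (B := D)
    (by omega) (fun i j hij => hmono (by omega))
    (Finset.card_pos.2 ⟨y, self_mem_ball _ _ _⟩) hDL
    (fun i hi _ => (key i hi (hinv i hi.le)).1)
  have h8 : (ball H' y (τ + 2 * L * L)).card ≤ (ball H' y m).card := hmono (by omega)
  omega

end

lemma sq_le_mul_two_pow (t : ℕ) : (20 + t) ^ 2 ≤ 400 * 2 ^ t := by
  induction t with
  | zero => norm_num
  | succ t ih =>
    have h : 2 * (20 + t) ^ 2 = (20 + (t + 1)) ^ 2 + (t * t + 38 * t + 359) := by ring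
    rw [pow_succ 2]
    omega

lemma card_support_erase_le {Γ : SimpleGraph V} {y z : V} (c : Γ.Walk y z) [DecidableEq V] :
    (c.support.toFinset.erase y).card ≤ c.length := by
  have h : c.support.toFinset.erase y ⊆ c.support.tail.toFinset := by
    intro x hx
    rw [Finset.mem_erase, List.mem_toFinset, SimpleGraph.Walk.mem_support_iff] at hx
    rw [List.mem_toFinset]
    tauto
  refine (Finset.card_le_card h).trans ((List.toFinset_card_le _).trans ?_)
  rw [List.length_tail, SimpleGraph.Walk.length_support]
  omega

section
variable [Fintype V]

open Classical in
/-- Around a vertex `y` of a shortest cycle in a subgraph of large minimum degree, the ball grows to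
size `D` even after deleting the rest of the cycle and a set `T` meeting balls about `y` slowly. -/
lemma cycle_growth {G Γ : SimpleGraph V} {W Y S T C Q : Finset V} {y : V} {D D₂ L k₀ a m δ : ℕ}
    (hgood : ∀ X : Finset V, Disjoint X W → Disjoint X Y → k₀ ≤ X.card → X.card ≤ D →
      X.card ^ 3 ≤ (bdry (del G W) X).card ^ 4 ∧ X.card ≤ L * (bdry (del G W) X).card)
    (hSW : Disjoint S W) (hSY : Disjoint S (spread G D₂ Y m))
    (hδ : ∀ v ∈ S, δ ≤ (nbrIn G v S).card) (hδ' : 1603 ≤ δ) (hkδ : k₀ + 3 ≤ δ)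
    (hΓ : Γ = del G Sᶜ) (c : Γ.Walk y y) (hc : c.IsCycle) (hg : ShortUniq Γ c.length)
    (hmemC : ∀ x, x ∈ C ↔ x ∈ c.support) (hQ : Q = (T ∪ C).erase y)
    (heven : Even c.length) (hlen : c.length < 2 * a + 4)
    (hyT : y ∉ T) (hT : ∀ i, (T ∩ ball (del G W) y i).card ≤ i)
    (hD₂ : D + W.card + T.card + (2 * a + 4) ≤ D₂) (hm : 3 * L * L + 1 ≤ m) (hL : 1 ≤ L)
    (hDL : D ≤ 2 ^ L) (haL : (2 * a + 40) ^ 2 ≤ 2 ^ (L * L - 1)) :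
    D ≤ (ball (del G (W ∪ Q)) y m).card := by
  have hWS : W ⊆ Sᶜ := fun x hx => Finset.mem_compl.2 fun h => Finset.disjoint_left.1 hSW h hx
  have hΓH : Γ ≤ del G W := hΓ ▸ del_anti G hWS
  have hS : ∀ u v, Γ.Adj u v → v ∈ S := fun u v h => by
    rw [hΓ] at h
    have := h.2.2
    rwa [Finset.mem_compl, not_not] at this
  have hyS : y ∈ S := hS _ _ (c.adj_penultimate hc.not_nil)
  have hyW : y ∉ W := Finset.disjoint_left.1 hSW hyS
  have hΓδ : ∀ v ∈ S, δ ≤ (nbrIn Γ v Finset.univ).card := by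
    intro v hv
    refine (hδ v hv).trans (Finset.card_le_card fun u hu => ?_)
    obtain ⟨hu, h⟩ := mem_nbrIn.1 hu
    exact mem_nbrIn.2 ⟨Finset.mem_univ _, hΓ ▸ ⟨h, by simpa using hv, by simpa using hu⟩⟩
  have h3 := hc.three_le_length
  obtain ⟨r, hr⟩ := heven
  have hLL : 1 ≤ L * L := Nat.mul_pos hL hL
  obtain ⟨τ, hτ⟩ : ∃ τ, min (r - 1) (L * L) = τ + 1 :=
    ⟨min (r - 1) (L * L) - 1, by omega⟩
  have hlev := card_level_ge (C := C) (T := T) (τ := τ) hg hyS hS hΓδ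
    (card_nbrIn_shortest_cycle hc hg hmemC)
    (fun z hz hzy => by
      obtain ⟨q, h1, h2, h3, -⟩ := exists_arc hc ((hmemC z).1 hz) hzy
      exact ⟨q, h1, h2, fun x hx => (hmemC x).2 (h3 x hx)⟩)
    hyT (fun i => (Finset.card_le_card
      (Finset.inter_subset_inter_left (ball_mono_graph hΓH y i))).trans (hT i))
    (by omega) (by omega)
  have hsub : level Γ y (C ∪ T) (τ + 1) ⊆ ball (del G (W ∪ Q)) y (τ + 1) := by
    intro u hu
    obtain ⟨p, -, hlen, havoid⟩ := mem_level.1 hu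
    subst hΓ
    obtain ⟨q, hq⟩ := exists_walk_del (W := W ∪ Q) (del_le G Sᶜ) p (by
      intro x hx hxm
      rcases Finset.mem_union.1 hxm with h | h
      · exact walk_del_avoid p (by simpa using hyS) x hx (hWS h)
      · rw [hQ, Finset.mem_erase, Finset.union_comm] at h
        exact h.1 (havoid x hx h.2))
    exact mem_ball.2 ⟨q, by omega⟩
  have hball := hlev.trans (Finset.card_le_card hsub)
  have hsq : (36 + c.length) ^ 2 ≤ (δ - 3) * 2 ^ τ := by
    by_cases hcase : r - 1 ≤ L * L
    · obtain ⟨t, rfl⟩ : ∃ t, r = t + 2 := ⟨r - 2, by omega⟩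
      obtain rfl : τ = t := by omega
      have h1 := sq_le_mul_two_pow τ
      have h2 : 1600 * 2 ^ τ ≤ (δ - 3) * 2 ^ τ := Nat.mul_le_mul_right _ (by omega)
      have h4 : (36 + c.length) ^ 2 = 4 * (20 + τ) ^ 2 := by rw [hr]; ring
      omega
    · obtain rfl : τ = L * L - 1 := by omega
      calc (36 + c.length) ^ 2 ≤ (2 * a + 40) ^ 2 := Nat.pow_le_pow_left (by omega) 2
        _ ≤ 1 * 2 ^ (L * L - 1) := by rw [one_mul]; exact haL
        _ ≤ _ := Nat.mul_le_mul_right _ (by omega)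
  have hQsub : Q ⊆ T ∪ C.erase y := by
    intro x hx
    simp only [hQ, Finset.mem_erase, Finset.mem_union] at hx ⊢
    tauto
  have hCe : (C.erase y).card ≤ c.length := by
    rw [show C = c.support.toFinset by ext x; rw [hmemC, List.mem_toFinset]]
    exact card_support_erase_le c
  refine ball_growth (A := 36 + c.length) (g := c.length) (τ := τ + 1) hgood hyW
    (hQ ▸ Finset.notMem_erase y _) (fun i => ?_) ?_ (Finset.disjoint_left.1 hSY hyS) (by omega)
    (by omega) (by omega) (hsq.trans hball) ?_ ?_ hL hDL
  · have h1 : Q ∩ ball (del G W) y i ⊆ (T ∩ ball (del G W) y i) ∪ C.erase y := by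
      intro x hx
      have := hQsub (Finset.mem_inter.1 hx).1
      have := (Finset.mem_inter.1 hx).2
      simp only [Finset.mem_union, Finset.mem_inter] at *
      tauto
    have h2 := Finset.card_le_card h1
    have h4 := Finset.card_union_le (T ∩ ball (del G W) y i) (C.erase y)
    have h5 := hT i
    omega
  · have h1 := Finset.card_le_card hQsub
    have h2 := Finset.card_union_le T (C.erase y)
    omega
  · have h1 : (δ - 3) * 1 ≤ (δ - 3) * 2 ^ τ := Nat.mul_le_mul_left _ Nat.one_le_two_pow
    omega
  · have : τ + 1 ≤ L * L := by omega
    nlinarith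

end

lemma cycle_split {Γ : SimpleGraph V} {x : V} (c : Γ.Walk x x) (hc : c.IsCycle) {r : ℕ}
    (hr : c.length = r + r) :
    ∃ y, y ≠ x ∧ y ∈ c.support ∧ ∃ p q : Γ.Walk x y, p.IsPath ∧ q.IsPath ∧ p.length + 1 = r ∧
      q.length = r + 1 ∧ (∀ z ∈ p.support, z ∈ c.support) ∧ ∀ z ∈ q.support, z ∈ c.support := by
  have h3 := hc.three_le_length
  refine ⟨c.getVert (r - 1), ?_, c.getVert_mem_support _, c.take (r - 1),
    (c.drop (r - 1)).reverse, hc.isPath_take (by omega), (hc.isPath_drop (by omega)).reverse,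
    ?_, ?_, fun z hz => ?_, fun z hz => ?_⟩
  · intro h
    have := hc.getVert_injOn' (show r - 1 ∈ {i | i ≤ c.length - 1} by simp; omega)
      (show 0 ∈ {i | i ≤ c.length - 1} by simp) (by rw [h, c.getVert_zero])
    omega
  · rw [SimpleGraph.Walk.take_length]; omega
  · rw [SimpleGraph.Walk.length_reverse, SimpleGraph.Walk.drop_length]; omega
  · rw [SimpleGraph.Walk.support_take] at hz
    exact List.mem_of_mem_take hz
  · rw [SimpleGraph.Walk.support_reverse, List.mem_reverse,
      SimpleGraph.Walk.drop_support_eq_support_drop_min] at hz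
    exact List.mem_of_mem_drop hz

section
variable [Fintype V]

open Classical in
/-- From `v` one can reach a new vertex `y` by two paths whose lengths differ by two, such that `y`
still expands after the deletion of these paths. -/
lemma exists_switch {G : SimpleGraph V} {W Y S : Finset V} {v : V} {f : V → Bool}
    {D D₂ L k₀ a m δ ρ : ℕ} (hf : ∀ u v, G.Adj u v → f u ≠ f v) (hcard : Fintype.card V < 2 ^ a)
    (hgood : ∀ X : Finset V, Disjoint X W → Disjoint X Y → k₀ ≤ X.card → X.card ≤ D →
      X.card ^ 3 ≤ (bdry (del G W) X).card ^ 4 ∧ X.card ≤ L * (bdry (del G W) X).card)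
    (hconn : ∀ u v, D ≤ (ball (del G W) u m).card → D ≤ (ball (del G W) v m).card →
      ∃ p : (del G W).Walk u v, p.IsPath ∧ p.length ≤ ρ)
    (hne : S.Nonempty) (hSW : Disjoint S W) (hSY : Disjoint S (spread G D₂ Y m))
    (hδ : ∀ v ∈ S, δ ≤ (nbrIn G v S).card) (hδ' : 1603 ≤ δ) (hkδ : k₀ + 3 ≤ δ)
    (hD₂ : D + W.card + ρ + (2 * a + 4) ≤ D₂) (hm : 3 * L * L + 1 ≤ m) (hL : 1 ≤ L)
    (hDL : D ≤ 2 ^ L) (haL : (2 * a + 40) ^ 2 ≤ 2 ^ (L * L - 1))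
    (hvW : v ∉ W) (hv : D ≤ (ball (del G W) v m).card) :
    ∃ (y : V) (h : ℕ) (p q : G.Walk v y) (U : Finset V), p.IsPath ∧ q.IsPath ∧ p.length = h ∧
      q.length = h + 2 ∧ (∀ z ∈ p.support, z ∈ U) ∧ (∀ z ∈ q.support, z ∈ U) ∧ Disjoint U W ∧
      y ≠ v ∧ U.card ≤ 2 * h + 2 ∧ 1 ≤ h ∧ h ≤ ρ + a ∧
      D ≤ (ball (del G (W ∪ U.erase y)) y m).card := by
  obtain ⟨Γ, hΓ⟩ : ∃ Γ, Γ = del G Sᶜ := ⟨_, rfl⟩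
  have hΓG : Γ ≤ G := hΓ ▸ del_le G _
  have hS : ∀ u v, Γ.Adj u v → v ∈ S := fun u v h => by
    rw [hΓ] at h
    have := h.2.2
    rwa [Finset.mem_compl, not_not] at this
  have hΓδ : ∀ v ∈ S, δ ≤ (nbrIn Γ v Finset.univ).card := by
    intro v hv
    refine (hδ v hv).trans (Finset.card_le_card fun u hu => ?_)
    obtain ⟨hu, h⟩ := mem_nbrIn.1 hu
    exact mem_nbrIn.2 ⟨Finset.mem_univ _, hΓ ▸ ⟨h, by simpa using hv, by simpa using hu⟩⟩
  obtain ⟨y₀, c₀, hc₀, hg, hlen⟩ := exists_shortest_cycle hne hS hΓδ (by omega) hcard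
  set C := c₀.support.toFinset with hC
  have hmemC : ∀ x, x ∈ C ↔ x ∈ c₀.support := fun x => List.mem_toFinset
  have heven : Even c₀.length := by
    rw [← SimpleGraph.Walk.length_mapLe hΓG c₀, walk_parity hf]
  have hCS : ∀ x ∈ C, x ∈ S := by
    have hy₀ : y₀ ∈ Sᶜᶜ := by
      rw [compl_compl]; exact hS _ _ (c₀.adj_penultimate hc₀.not_nil)
    intro x hx
    subst hΓ
    have := walk_del_avoid c₀ (by simpa using hy₀) x ((hmemC x).1 hx)
    rwa [Finset.mem_compl, not_not] at this
  have hCW : ∀ x ∈ C, x ∉ W := fun x hx => Finset.disjoint_left.1 hSW (hCS x hx)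
  have hgrow₀ := cycle_growth (T := ∅) (C := C) hgood hSW hSY hδ hδ' hkδ hΓ c₀ hc₀ hg hmemC rfl
    heven hlen (Finset.notMem_empty _) (by simp) (by simp; omega) hm hL hDL haL
  obtain ⟨p₀, -, hp₀⟩ := hconn v y₀ hv (hgrow₀.trans (Finset.card_le_card
    (ball_mono_graph (del_anti G Finset.subset_union_left) y₀ m)))
  have hex : ∃ k, ∃ x ∈ C, ∃ p : (del G W).Walk v x, p.length = k :=
    ⟨_, y₀, (hmemC _).2 c₀.start_mem_support, p₀, rfl⟩
  obtain ⟨x, hxC, p', hp'⟩ := Nat.find_spec hex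
  have hmin : ∀ z ∈ C, ∀ q : (del G W).Walk v z, Nat.find hex ≤ q.length :=
    fun z hz q => Nat.find_min' hex ⟨z, hz, q, rfl⟩
  have hkρ : Nat.find hex ≤ ρ := (hmin _ ((hmemC _).2 c₀.start_mem_support) p₀).trans hp₀
  set k := Nat.find hex with hk
  obtain ⟨p, hp, hpk⟩ : ∃ p : (del G W).Walk v x, p.IsPath ∧ p.length = k :=
    ⟨p'.bypass, p'.bypass_isPath,
      le_antisymm (p'.length_bypass_le_length.trans hp'.le) (hmin x hxC _)⟩
  have hpC : ∀ z ∈ p.support, z ∈ C → z = x := by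
    intro z hz hzC
    by_contra hne
    have h1 := SimpleGraph.Walk.length_takeUntil_lt_length hz hne
    have h2 := hmin z hzC (p.takeUntil z hz)
    omega
  set T := p.support.toFinset.erase x with hT
  obtain ⟨r, hr⟩ := heven
  obtain ⟨y, hyx, hyc, A, B, hA, hB, hAl, hBl, hAs, hBs⟩ :=
    cycle_split (c₀.rotate x ((hmemC x).1 hxC)) (hc₀.rotate _) (r := r)
      (by rw [SimpleGraph.Walk.length_rotate]; exact hr)
  have hrot : ∀ z u (hu : u ∈ c₀.support), z ∈ (c₀.rotate u hu).support ↔ z ∈ C :=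
    fun z u hu => (SimpleGraph.Walk.mem_support_rotate_iff ..).trans (hmemC z).symm
  simp only [hrot] at hyc hAs hBs
  have hpW := walk_del_avoid p hvW
  have hpU : ∀ z ∈ p.support, z ∈ T ∪ C := by
    intro z hz
    by_cases hzx : z = x
    · exact Finset.mem_union_right _ (hzx ▸ hxC)
    · exact Finset.mem_union_left _ (Finset.mem_erase.2 ⟨hzx, List.mem_toFinset.2 hz⟩)
  have hTk : T ⊆ (Finset.range k).image p.getVert := by
    intro t ht
    obtain ⟨htx, ht⟩ := Finset.mem_erase.1 ht
    obtain ⟨j, rfl, hj⟩ := SimpleGraph.Walk.mem_support_iff_exists_getVert.1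
      (List.mem_toFinset.1 ht)
    refine Finset.mem_image.2 ⟨j, Finset.mem_range.2 (lt_of_le_of_ne (hpk ▸ hj) ?_), rfl⟩
    rintro rfl
    exact htx (by rw [← hpk, p.getVert_length])
  have hTcard : T.card ≤ k := by
    simpa using (Finset.card_le_card hTk).trans Finset.card_image_le
  have hCcard : C.card ≤ r + r := by
    have h1 : (C.erase y₀).card ≤ c₀.length := card_support_erase_le c₀
    have h2 : C ⊆ c₀.support.tail.toFinset := by
      intro z hz
      rw [hmemC] at hz
      rw [List.mem_toFinset]
      rcases (SimpleGraph.Walk.mem_support_iff _).1 hz with h | h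
      · rw [h]; exact SimpleGraph.Walk.end_mem_tail_support hc₀.not_nil
      · exact h
    refine (Finset.card_le_card h2).trans ((List.toFinset_card_le _).trans ?_)
    rw [List.length_tail, SimpleGraph.Walk.length_support]
    omega
  have hyT : y ∉ T := by
    intro h
    obtain ⟨h1, h2⟩ := Finset.mem_erase.1 h
    exact h1 (hpC y (List.mem_toFinset.1 h2) hyc)
  have hTi : ∀ i, (T ∩ ball (del G W) y i).card ≤ i := by
    intro i
    have hsub : T ∩ ball (del G W) y i ⊆ (Finset.Ico (k - i) k).image p.getVert := by
      intro t ht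
      obtain ⟨ht, hti⟩ := Finset.mem_inter.1 ht
      obtain ⟨j, hj, rfl⟩ := Finset.mem_image.1 (hTk ht)
      obtain ⟨w, hw⟩ := mem_ball.1 hti
      have h1 := hmin y hyc ((p.take j).append w.reverse)
      rw [SimpleGraph.Walk.length_append, SimpleGraph.Walk.take_length,
        SimpleGraph.Walk.length_reverse] at h1
      have := Finset.mem_range.1 hj
      exact Finset.mem_image.2 ⟨j, Finset.mem_Ico.2 ⟨by omega, by omega⟩, rfl⟩
    refine (Finset.card_le_card hsub).trans (Finset.card_image_le.trans ?_)
    rw [Nat.card_Ico]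
    omega
  have hglue : ∀ B : Γ.Walk x y, B.IsPath → (∀ z ∈ B.support, z ∈ C) →
      ((p.mapLe (del_le G W)).append (B.mapLe hΓG)).IsPath ∧
      ∀ z ∈ ((p.mapLe (del_le G W)).append (B.mapLe hΓG)).support, z ∈ T ∪ C := by
    intro B hB hBs
    constructor
    · refine isPath_append (hp.mapLe _) (hB.mapLe _) fun z hz hz' => ?_
      rw [SimpleGraph.Walk.support_mapLe_eq_support] at hz hz'
      exact hpC z hz (hBs z hz')
    · intro z hz
      rw [SimpleGraph.Walk.mem_support_append_iff, SimpleGraph.Walk.support_mapLe_eq_support,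
        SimpleGraph.Walk.support_mapLe_eq_support] at hz
      rcases hz with h | h
      · exact hpU z h
      · exact Finset.mem_union_right _ (hBs z h)
  have h3 := hc₀.three_le_length
  have hU := Finset.card_union_le T C
  refine ⟨y, k + (r - 1), _, _, T ∪ C, (hglue A hA hAs).1, (hglue B hB hBs).1, ?_, ?_,
    (hglue A hA hAs).2, (hglue B hB hBs).2, ?_, ?_, by omega, by omega, by omega, ?_⟩
  · rw [SimpleGraph.Walk.length_append, SimpleGraph.Walk.length_mapLe,
      SimpleGraph.Walk.length_mapLe]
    omega
  · rw [SimpleGraph.Walk.length_append, SimpleGraph.Walk.length_mapLe,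
      SimpleGraph.Walk.length_mapLe]
    omega
  · rw [Finset.disjoint_left]
    intro z hz
    rcases Finset.mem_union.1 hz with h | h
    · exact hpW z (List.mem_toFinset.1 (Finset.mem_erase.1 h).2)
    · exact hCW z h
  · rintro rfl
    exact hyx (hpC _ p.start_mem_support hyc)
  · have hy0 := (hmemC y).1 hyc
    refine cycle_growth (T := T) (C := C) hgood hSW hSY hδ hδ' hkδ hΓ (c₀.rotate y hy0)
      (hc₀.rotate _) ?_ (fun z => (hrot z y hy0).symm) rfl ?_ ?_ hyT hTi (by omega) hm hL hDL haL
    · rw [SimpleGraph.Walk.length_rotate]; exact hg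
    · rw [SimpleGraph.Walk.length_rotate]; exact ⟨r, hr⟩
    · rw [SimpleGraph.Walk.length_rotate]; exact hlen

end

section
variable [Fintype V]

lemma le_card_ball_of_degree {G : SimpleGraph V} {W : Finset V} {v : V} {D w m : ℕ} (hv : v ∉ W)
    (hW : W.card ≤ w) (hdeg : D + w ≤ (nbrIn G v Finset.univ).card) (hm : 1 ≤ m) :
    D ≤ (ball (del G W) v m).card := by
  classical
  have hsub : nbrIn G v Finset.univ \ W ⊆ ball (del G W) v (0 + 1) := by
    intro u hu
    rw [Finset.mem_sdiff, mem_nbrIn] at hu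
    exact adj_mem_ball (self_mem_ball _ _ _) ⟨hu.1.2, hv, hu.2⟩
  have h1 := Finset.card_le_card hsub
  have h2 := Finset.le_card_sdiff W (nbrIn G v Finset.univ)
  have h3 := Finset.card_le_card (ball_mono (del G W) v (show 0 + 1 ≤ m by omega))
  omega

open Classical in
/-- Given the connecting and switching properties, two vertices of large degree on the same side are
joined by a path of a prescribed even length `ℓ`. -/
lemma exists_path_of_length {G : SimpleGraph V} {f : V → Bool} {D w₀ m ρ η ℓ : ℕ}
    (hf : ∀ u v, G.Adj u v → f u ≠ f v)
    (hconn : ∀ W : Finset V, W.card ≤ w₀ → ∀ u v, D ≤ (ball (del G W) u m).card →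
      D ≤ (ball (del G W) v m).card → ∃ p : (del G W).Walk u v, p.IsPath ∧ p.length ≤ ρ)
    (hswitch : ∀ (W : Finset V) (v : V), W.card ≤ w₀ → v ∉ W → D ≤ (ball (del G W) v m).card →
      ∃ (y : V) (h : ℕ) (p q : G.Walk v y) (U : Finset V), p.IsPath ∧ q.IsPath ∧ p.length = h ∧
      q.length = h + 2 ∧ (∀ z ∈ p.support, z ∈ U) ∧ (∀ z ∈ q.support, z ∈ U) ∧ Disjoint U W ∧
      y ≠ v ∧ U.card ≤ 2 * h + 2 ∧ 1 ≤ h ∧ h ≤ η ∧ D ≤ (ball (del G (W ∪ U.erase y)) y m).card)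
    (hm : 1 ≤ m) (hρη : ρ ≤ η) (hℓ : Even ℓ) (hηℓ : η * η + 2 * η ≤ ℓ) {W₀ : Finset V} {v₀ v₁ : V}
    (hv₀ : v₀ ∉ W₀) (hv₁ : v₁ ∉ W₀) (hne : v₀ ≠ v₁) (hfv : f v₀ = f v₁)
    (hW₀ : W₀.card + 2 * (ℓ + η + 2) + 1 ≤ w₀)
    (hd₀ : D + w₀ ≤ (nbrIn G v₀ Finset.univ).card)
    (hd₁ : D + w₀ ≤ (nbrIn G v₁ Finset.univ).card) :
    ∃ p : G.Walk v₀ v₁, p.IsPath ∧ p.length = ℓ ∧ ∀ x ∈ p.support, x ∉ W₀ := by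
  set W₁ := insert v₁ W₀ with hW₁
  have hW₁card : W₁.card ≤ W₀.card + 1 := Finset.card_insert_le _ _
  have key : ∀ t ≤ ℓ, ∃ (K S : ℕ) (y : V) (Q : Finset V), t ≤ S + 2 * K ∧
      S + 2 * K < ℓ + η + 2 ∧ S ≤ K * η ∧ Q.card ≤ 2 * (S + 2 * K) ∧ Disjoint Q W₁ ∧ y ∉ W₁ ∧
      y ∉ Q ∧ D ≤ (ball (del G (W₁ ∪ Q)) y m).card ∧
      ∀ j ≤ K, ∃ p : G.Walk v₀ y, p.IsPath ∧ p.length = S + 2 * j ∧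
        ∀ z ∈ p.support, z ∈ Q ∨ z = y := by
    intro t
    induction t with
    | zero =>
      intro _
      have hv₀W : v₀ ∉ W₁ := by simp [hW₁, hne, hv₀]
      refine ⟨0, 0, v₀, ∅, by omega, by omega, by simp, by simp, by simp, hv₀W, by simp, ?_, ?_⟩
      · rw [Finset.union_empty]
        exact le_card_ball_of_degree hv₀W (by omega) hd₀ hm
      · intro j hj
        exact ⟨.nil, by simp, by simp; omega, by simp⟩
    | succ t ih =>
      intro ht
      obtain ⟨K, S, y, Q, h1, h2, h3, h4, hQW, hyW, hyQ, hball, hpaths⟩ := ih (by omega)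
      by_cases hlt : t + 1 ≤ S + 2 * K
      · exact ⟨K, S, y, Q, hlt, h2, h3, h4, hQW, hyW, hyQ, hball, hpaths⟩
      have hcard := Finset.card_union_le W₁ Q
      obtain ⟨y', h, p, q, U, hp, hq, hpl, hql, hpU, hqU, hUW, hyy, hUc, hh1, hhη, hball'⟩ :=
        hswitch (W₁ ∪ Q) y (by omega) (by simp [hyW, hyQ]) hball
      rw [Finset.disjoint_union_right] at hUW
      have hyU := hpU _ p.start_mem_support
      have hyU' := hpU _ p.end_mem_support
      have hUe : (U.erase y').card + 1 = U.card := Finset.card_erase_add_one hyU'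
      have hQc := Finset.card_union_le Q (U.erase y')
      refine ⟨K + 1, S + h, y', Q ∪ U.erase y', by omega, by omega, by nlinarith, by omega, ?_,
        Finset.disjoint_left.1 hUW.1 hyU', ?_, ?_, ?_⟩
      · rw [Finset.disjoint_union_left]
        exact ⟨hQW, Finset.disjoint_of_subset_left (Finset.erase_subset _ _) hUW.1⟩
      · simp [Finset.disjoint_left.1 hUW.2 hyU']
      · rwa [← Finset.union_assoc]
      · have hglue : ∀ (r : G.Walk v₀ y) (p : G.Walk y y'), r.IsPath → p.IsPath →
            (∀ z ∈ r.support, z ∈ Q ∨ z = y) → (∀ z ∈ p.support, z ∈ U) →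
            (r.append p).IsPath ∧ ∀ z ∈ (r.append p).support, z ∈ Q ∪ U.erase y' ∨ z = y' := by
          intro r p hr hp hrQ hpU
          refine ⟨isPath_append hr hp fun z hz hz' => ?_, fun z hz => ?_⟩
          · exact (hrQ z hz).resolve_left (Finset.disjoint_left.1 hUW.2 (hpU z hz'))
          · have hzU : z ∈ U → z ∈ Q ∪ U.erase y' ∨ z = y' := by
              intro hz
              by_cases hzy : z = y'
              · exact Or.inr hzy
              · exact Or.inl (Finset.mem_union_right _ (Finset.mem_erase.2 ⟨hzy, hz⟩))
            rcases (SimpleGraph.Walk.mem_support_append_iff _ _).1 hz with hz | hz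
            · rcases hrQ z hz with hz | rfl
              · exact Or.inl (Finset.mem_union_left _ hz)
              · exact hzU hyU
            · exact hzU (hpU z hz)
        intro j hj
        by_cases hjK : j ≤ K
        · obtain ⟨r, hr, hrl, hrQ⟩ := hpaths j hjK
          obtain ⟨h5, h6⟩ := hglue r p hr hp hrQ hpU
          exact ⟨_, h5, by rw [SimpleGraph.Walk.length_append]; omega, h6⟩
        · obtain ⟨r, hr, hrl, hrQ⟩ := hpaths K le_rfl
          obtain ⟨h5, h6⟩ := hglue r q hr hq hrQ hqU
          exact ⟨_, h5, by rw [SimpleGraph.Walk.length_append]; omega, h6⟩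
  obtain ⟨K, S, y, Q, h1, h2, h3, h4, hQW, hyW, hyQ, hball, hpaths⟩ := key ℓ le_rfl
  have hQW₀ : Disjoint Q W₀ := Finset.disjoint_of_subset_right (Finset.subset_insert _ _) hQW
  have hv₁Q : v₁ ∉ Q := Finset.disjoint_right.1 hQW (Finset.mem_insert_self _ _)
  have hyW₀ : y ∉ W₀ := fun h => hyW (Finset.mem_insert_of_mem h)
  have hcard := Finset.card_union_le W₀ Q
  obtain ⟨r, hr, hrl⟩ := hconn (W₀ ∪ Q) (by omega) y v₁
    (hball.trans (Finset.card_le_card (ball_mono_graph (del_anti G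
      (Finset.union_subset_union_left (Finset.subset_insert _ _))) y m)))
    (le_card_ball_of_degree (by simp [hv₁, hv₁Q]) (by omega) hd₁ hm)
  have havoid := walk_del_avoid r (by simp [hyW₀, hyQ])
  have hSℓ : S + r.length ≤ ℓ := by
    by_contra! hcon
    have h5 : (S + 2 * K) * η < (ℓ + η + 2) * η + 1 := by nlinarith
    have h6 : ℓ + 1 ≤ S + η := by omega
    nlinarith
  have heven : Even (S + r.length) := by
    obtain ⟨p, -, hpl, -⟩ := hpaths 0 (Nat.zero_le _)
    have := (walk_parity hf (p.append (r.mapLe (del_le G _)))).2 hfv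
    rwa [SimpleGraph.Walk.length_append, SimpleGraph.Walk.length_mapLe, hpl] at this
  obtain ⟨a, ha⟩ := hℓ
  obtain ⟨b, hb⟩ := heven
  obtain ⟨p, hp, hpl, hpQ⟩ := hpaths (a - b) (by omega)
  refine ⟨p.append (r.mapLe (del_le G _)), isPath_append hp (hr.mapLe _) fun z hz hz' => ?_, ?_,
    fun z hz hzW => ?_⟩
  · rw [SimpleGraph.Walk.support_mapLe_eq_support] at hz'
    exact (hpQ z hz).resolve_left fun h => havoid z hz' (Finset.mem_union_right _ h)
  · rw [SimpleGraph.Walk.length_append, SimpleGraph.Walk.length_mapLe, hpl]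
    omega
  · rcases (SimpleGraph.Walk.mem_support_append_iff _ _).1 hz with hz | hz
    · rcases hpQ z hz with hz | rfl
      · exact Finset.disjoint_left.1 hQW₀ hz hzW
      · exact hyW₀ hzW
    · rw [SimpleGraph.Walk.support_mapLe_eq_support] at hz
      exact havoid z hz (Finset.mem_union_left _ hzW)

end

open Classical in
/-- Linking a set of core vertices pair by pair with paths of length `ℓ` that avoid everything used
before gives a balanced subdivision of a complete graph. -/
lemma containsBalSub_of_link {G : SimpleGraph V} {κ ℓ M : ℕ} (c : Fin κ → V)
    (hc : Function.Injective c) (hM : κ + κ * κ * (ℓ + 1) ≤ M)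
    (hlink : ∀ (W : Finset V) (i j : Fin κ), W.card ≤ M → c i ∉ W → c j ∉ W → c i ≠ c j →
      ∃ p : G.Walk (c i) (c j), p.IsPath ∧ p.length = ℓ ∧ ∀ x ∈ p.support, x ∉ W) :
    ContainsBalSub G κ ℓ := by
  have key : ∀ s : Finset (Fin κ × Fin κ), ∃ I : Fin κ × Fin κ → Finset V,
      (∀ e ∈ s, (I e).card ≤ ℓ + 1 ∧ (∀ i, c i ∉ I e) ∧ (∀ e' ∈ s, e ≠ e' → Disjoint (I e) (I e')) ∧
        (e.1 < e.2 → ∃ p : G.Walk (c e.1) (c e.2), p.IsPath ∧ p.length = ℓ ∧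
          ∀ x ∈ p.support, x = c e.1 ∨ x = c e.2 ∨ x ∈ I e)) := by
    intro s
    induction s using Finset.induction_on with
    | empty => exact ⟨fun _ => ∅, by simp⟩
    | insert e s he ih =>
      obtain ⟨I, hI⟩ := ih
      have hex : ∃ J : Finset V, J.card ≤ ℓ + 1 ∧ (∀ i, c i ∉ J) ∧
          (∀ e' ∈ s, Disjoint J (I e')) ∧
          (e.1 < e.2 → ∃ p : G.Walk (c e.1) (c e.2), p.IsPath ∧ p.length = ℓ ∧
            ∀ x ∈ p.support, x = c e.1 ∨ x = c e.2 ∨ x ∈ J) := by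
        by_cases hlt : e.1 < e.2
        · set W := (Finset.univ.image c \ {c e.1, c e.2}) ∪ s.biUnion I with hW
          have hWc : W.card ≤ M := by
            refine (Finset.card_union_le _ _).trans (le_trans (add_le_add ?_ ?_) hM)
            · refine (Finset.card_le_card Finset.sdiff_subset).trans (Finset.card_image_le.trans ?_)
              simp
            · refine (Finset.card_biUnion_le_card_mul s I (ℓ + 1) fun e he => (hI e he).1).trans
                (Nat.mul_le_mul_right _ ?_)
              simpa using Finset.card_le_univ s
          have hcI : ∀ i, c i ∉ s.biUnion I := by
            intro i hi
            obtain ⟨e', he', hi⟩ := Finset.mem_biUnion.1 hi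
            exact (hI e' he').2.1 i hi
          obtain ⟨p, hp, hpl, hpW⟩ := hlink W e.1 e.2 hWc (by simp [hW, -Finset.mem_biUnion, hcI])
            (by simp [hW, -Finset.mem_biUnion, hcI]) fun h => hlt.ne (hc h)
          refine ⟨p.support.toFinset \ {c e.1, c e.2}, ?_, ?_, ?_, fun _ => ⟨p, hp, hpl, ?_⟩⟩
          · refine (Finset.card_le_card Finset.sdiff_subset).trans
              ((List.toFinset_card_le _).trans ?_)
            rw [SimpleGraph.Walk.length_support, hpl]
          · intro i hi
            rw [Finset.mem_sdiff, List.mem_toFinset] at hi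
            exact hpW _ hi.1 (Finset.mem_union_left _ (Finset.mem_sdiff.2
              ⟨Finset.mem_image_of_mem _ (Finset.mem_univ _), hi.2⟩))
          · intro e' he'
            rw [Finset.disjoint_left]
            intro x hx hx'
            rw [Finset.mem_sdiff, List.mem_toFinset] at hx
            exact hpW _ hx.1 (Finset.mem_union_right _ (Finset.mem_biUnion.2 ⟨e', he', hx'⟩))
          · intro x hx
            simp only [Finset.mem_sdiff, List.mem_toFinset, Finset.mem_insert,
              Finset.mem_singleton]
            tauto
        · exact ⟨∅, by simp, by simp, by simp, fun h => absurd h hlt⟩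
      obtain ⟨J, hJ1, hJ2, hJ3, hJ4⟩ := hex
      have hupd : ∀ e' ∈ s, Function.update I e J e' = I e' := fun e' he' =>
        Function.update_of_ne (by rintro rfl; exact he he') _ _
      refine ⟨Function.update I e J, fun e₁ he₁ => ?_⟩
      rcases Finset.mem_insert.1 he₁ with rfl | hs₁
      · rw [Function.update_self]
        refine ⟨hJ1, hJ2, fun e' he' hne => ?_, hJ4⟩
        rcases Finset.mem_insert.1 he' with rfl | he'
        · exact absurd rfl hne
        · rw [hupd _ he']; exact hJ3 _ he'
      · rw [hupd _ hs₁]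
        obtain ⟨h1, h2, h3, h4⟩ := hI e₁ hs₁
        refine ⟨h1, h2, fun e' he' hne => ?_, h4⟩
        rcases Finset.mem_insert.1 he' with rfl | he'
        · rw [Function.update_self]; exact (hJ3 _ hs₁).symm
        · rw [hupd _ he']; exact h3 _ he' hne
  obtain ⟨I, hI⟩ := key Finset.univ
  choose P hP1 hP2 hP3 using fun e => (hI e (Finset.mem_univ e)).2.2.2
  refine ⟨c, hc, fun i j h => P (i, j) h, fun i j h => ⟨hP1 _ h, hP2 _ h⟩, ?_, ?_⟩
  · intro i j h q hq
    rcases hP3 _ h _ hq with h1 | h1 | h1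
    · exact Or.inl (hc h1)
    · exact Or.inr (hc h1)
    · exact absurd h1 ((hI _ (Finset.mem_univ _)).2.1 q)
  · intro i j h i' j' h' hne x hx hx'
    have hdis := (hI _ (Finset.mem_univ _)).2.2.1 _ (Finset.mem_univ _) hne
    have hcI := fun e => (hI e (Finset.mem_univ e)).2.1
    rcases hP3 _ h _ hx with rfl | rfl | h1 <;> rcases hP3 _ h' _ hx' with h2 | h2 | h2
    · exact ⟨Or.inl rfl, Or.inl h2⟩
    · exact ⟨Or.inl rfl, Or.inr h2⟩
    · exact absurd h2 (hcI _ _)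
    · exact ⟨Or.inr rfl, Or.inl h2⟩
    · exact ⟨Or.inr rfl, Or.inr h2⟩
    · exact absurd h2 (hcI _ _)
    · exact absurd (h2 ▸ h1) (hcI _ _)
    · exact absurd (h2 ▸ h1) (hcI _ _)
    · exact absurd h2 (Finset.disjoint_left.1 hdis h1)

section
variable [Fintype V]

lemma containsBalSub_of_parameters {G : SimpleGraph V} {f : V → Bool} {k : ℝ}
    {w₀ D D₂ L q b B R a m δ k₀ κ ℓ η ρ : ℕ} (hf : ∀ u v, G.Adj u v → f u ≠ f v)
    (hG : IsExpander G 1 k) (hk : 0 < k) (hfree : ¬ ContainsBalSub G q 2)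
    (hdeg : ∀ v, b ≤ (nbrIn G v Finset.univ).card) (hq : 2 * q ≤ b + 1) (hδ : 5 * δ ≤ b + 4)
    (hδ' : 1603 ≤ δ) (hkδ : k₀ + 3 ≤ δ) (hk₀ : k / 2 ≤ k₀) (hkw : k ≤ w₀) (hR : 0 < R)
    (hlogn : Real.log (15 * Fintype.card V / k) ≤ 2 * R)
    (hlog : 2 * Real.log (15 * (w₀ * D : ℕ) / k) ^ 2 < L)
    (hlog' : ∀ x e : ℕ, k / 2 ≤ x → e ^ 4 < x ^ 3 →
      Real.log (15 * (b * x ^ 2 : ℕ) / k) ^ 2 * (1 + e) < x)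
    (hn : 2 * (w₀ * D) ≤ Fintype.card V) (hn' : 2 * (b * (L ^ 4) ^ 2) ≤ Fintype.card V)
    (hB : k / 2 ≤ (L : ℝ) ^ 4 →
      (b * L ^ 4) * ((L ^ 4 + 1) * ((L ^ 4 * b + 1) * (w₀ + 1) ^ (L ^ 4 * b))) ≤ B)
    (hcard : Fintype.card V < 2 ^ a)
    (hZ : 10 * ((w₀ + (w₀ ^ 2 + (w₀ + B) * D) * (1 + D₂) ^ m) +
      (w₀ + (w₀ ^ 2 + (w₀ + B) * D) * (1 + D₂) ^ m) ^ 2) ≤ Fintype.card V)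
    (hD : 16 * R ^ 2 * w₀ ≤ D) (hρ : ρ = 2 * (m + 8 * R ^ 2 * a)) (hη : η = ρ + a)
    (hD₂ : D + w₀ + ρ + (2 * a + 4) ≤ D₂) (hm : 3 * L * L + 1 ≤ m) (hL : 1 ≤ L)
    (hDL : D ≤ 2 ^ L) (haL : (2 * a + 40) ^ 2 ≤ 2 ^ (L * L - 1))
    (hℓ : Even ℓ) (hηℓ : η * η + 2 * η ≤ ℓ)
    (hw : κ + κ * κ * (ℓ + 1) + 2 * (ℓ + η + 2) + 1 ≤ w₀)
    (c : Fin κ → V) (hc : Function.Injective c) (hcf : ∀ i j, f (c i) = f (c j))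
    (hcdeg : ∀ i, D + w₀ ≤ (nbrIn G (c i) Finset.univ).card) :
    ContainsBalSub G κ ℓ := by
  classical
  have hconn : ∀ W : Finset V, W.card ≤ w₀ → ∀ u v, D ≤ (ball (del G W) u m).card →
      D ≤ (ball (del G W) v m).card → ∃ p : (del G W).Walk u v, p.IsPath ∧ p.length ≤ ρ := by
    intro W hW u v hu hv
    rw [hρ]
    exact exists_path_of_large_balls (by positivity) hcard
      (fun X hX hX' => hG.large_expansion hk hR hkw hlogn hW X (hD.trans hX) hX') hu hv
  refine containsBalSub_of_link (M := κ + κ * κ * (ℓ + 1)) c hc le_rfl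
    fun W i j hW hi hj hne => exists_path_of_length (η := η) hf hconn ?_ (by omega) (by omega) hℓ
      hηℓ hi hj hne (hcf i j) (by omega) (hcdeg i) (hcdeg j)
  intro W v hW hvW hv
  obtain ⟨Y, hYcard, hY⟩ := exists_exceptional_set hG hk (by omega) hL (by omega) (by omega) hfree
    hlog hlog' hn hn' hB hW
  have hspread : (spread G D₂ Y m).card ≤ (w₀ ^ 2 + (w₀ + B) * D) * (1 + D₂) ^ m :=
    (card_spread_le G D₂ Y m).trans (Nat.mul_le_mul_right _ hYcard)
  have hZcard : (W ∪ spread G D₂ Y m).card ≤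
      w₀ + (w₀ ^ 2 + (w₀ + B) * D) * (1 + D₂) ^ m :=
    (Finset.card_union_le _ _).trans (add_le_add hW hspread)
  obtain ⟨S, hSZ, hne, hS⟩ := exists_min_degree_avoiding hfree hdeg hq hδ (by omega)
    (Fintype.card_pos_iff.2 ⟨v⟩) (W ∪ spread G D₂ Y m)
    (le_trans (Nat.mul_le_mul_left _ (add_le_add hZcard (Nat.pow_le_pow_left hZcard 2))) hZ)
  rw [Finset.disjoint_union_right] at hSZ
  rw [hη]
  exact exists_switch hf hcard
    (fun X h1 h2 h3 h4 => hY X h1 h2 (hk₀.trans (by exact_mod_cast h3)) h4)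
    (hconn W hW) hne hSZ.1 hSZ.2 hS hδ' hkδ (by omega) hm hL hDL haL hvW hv

end

lemma path_length_le {R m a ρ η : ℕ} (hR : 10 ^ 4 ≤ R) (hm : m ≤ R) (ha : a ≤ 2 * R)
    (hρ : ρ = 2 * (m + 8 * R ^ 2 * a)) (hη : η = ρ + a) : η ≤ 33 * R ^ 3 := by
  have h1 : R ^ 2 * a ≤ R ^ 2 * (2 * R) := Nat.mul_le_mul_left _ ha
  have h2 : 4 * R ≤ R ^ 3 := by
    have : 4 * R ≤ R ^ 2 * R := Nat.mul_le_mul_right _ (by nlinarith)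
    rwa [← pow_succ] at this
  have h3 : R ^ 2 * (2 * R) = 2 * R ^ 3 := by ring
  have h4 : 8 * R ^ 2 * a = 8 * (R ^ 2 * a) := by ring
  omega

lemma used_vertices_le {R κ η ℓ : ℕ} (hR : 10 ^ 4 ≤ R) (hκ : 1 ≤ κ) (hη : η ≤ 33 * R ^ 3)
    (hℓ : ℓ = 2 * (η * (η + 2))) :
    κ + κ * κ * (ℓ + 1) + 2 * (ℓ + η + 2) + 1 ≤ κ ^ 2 * R ^ 7 := by
  have h1 : η + 2 ≤ 34 * R ^ 3 := by
    have : R ≤ R ^ 3 := Nat.le_self_pow (by norm_num) R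
    omega
  have h2 : ℓ ≤ 2244 * R ^ 6 := by
    calc ℓ = 2 * (η * (η + 2)) := hℓ
      _ ≤ 2 * ((33 * R ^ 3) * (34 * R ^ 3)) := by gcongr
      _ = 2244 * R ^ 6 := by ring
  have h3 : R ^ 3 ≤ R ^ 6 := Nat.pow_le_pow_right (by omega) (by norm_num)
  have h4 : 1 ≤ R ^ 6 := Nat.one_le_pow _ _ (by omega)
  have h5 : 3 * ℓ + 2 * η + 7 ≤ R ^ 7 := by
    calc 3 * ℓ + 2 * η + 7 ≤ 10 ^ 4 * R ^ 6 := by omega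
      _ ≤ R * R ^ 6 := by gcongr
      _ = R ^ 7 := by ring
  have h6 : 1 ≤ κ * κ := Nat.mul_pos hκ hκ
  have h7 : κ ≤ κ * κ := Nat.le_mul_self κ
  calc κ + κ * κ * (ℓ + 1) + 2 * (ℓ + η + 2) + 1
      ≤ κ * κ + κ * κ * (ℓ + 1) + κ * κ * (2 * (ℓ + η + 2) + 1) := by nlinarith
    _ = κ ^ 2 * (3 * ℓ + 2 * η + 7) := by ring
    _ ≤ _ := Nat.mul_le_mul_left _ h5

lemma forbidden_card_le {w₀ D D₂ B L m n : ℕ} (hL : 100 ≤ L) (hm : m = 3 * L * L + 1)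
    (hw : w₀ ≤ 2 ^ L) (hD : D ≤ 2 ^ L) (hD₂ : 1 + D₂ ≤ 2 ^ L) (hB : B ≤ 2 ^ (L ^ 10 + 24 * L))
    (hn : 2 ^ (L ^ 16) ≤ n) :
    10 * ((w₀ + (w₀ ^ 2 + (w₀ + B) * D) * (1 + D₂) ^ m) +
      (w₀ + (w₀ ^ 2 + (w₀ + B) * D) * (1 + D₂) ^ m) ^ 2) ≤ n := by
  set E := L ^ 10 + 27 * L + L * (3 * L * L + 1) with hE
  have h0 : 1 ≤ L ^ 10 := Nat.one_le_pow _ _ (by omega)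
  have h1 : w₀ ^ 2 + (w₀ + B) * D ≤ 2 ^ (L ^ 10 + 26 * L) := by
    have h2 : w₀ ^ 2 ≤ 2 ^ (L ^ 10 + 25 * L) :=
      calc w₀ ^ 2 ≤ (2 ^ L) ^ 2 := Nat.pow_le_pow_left hw 2
        _ = 2 ^ (L * 2) := by rw [pow_mul]
        _ ≤ _ := Nat.pow_le_pow_right (by norm_num) (by omega)
    have h3 : w₀ + B ≤ 2 ^ (L ^ 10 + 24 * L + 1) := by
      have : 2 ^ L ≤ 2 ^ (L ^ 10 + 24 * L) := Nat.pow_le_pow_right (by norm_num) (by omega)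
      rw [pow_succ]; omega
    have h4 : (w₀ + B) * D ≤ 2 ^ (L ^ 10 + 24 * L + 1) * 2 ^ L := Nat.mul_le_mul h3 hD
    rw [← pow_add] at h4
    have h5 : 2 ^ (L ^ 10 + 24 * L + 1 + L) ≤ 2 ^ (L ^ 10 + 26 * L - 1) :=
      Nat.pow_le_pow_right (by norm_num) (by omega)
    have h6 : 2 ^ (L ^ 10 + 25 * L) ≤ 2 ^ (L ^ 10 + 26 * L - 1) :=
      Nat.pow_le_pow_right (by norm_num) (by omega)
    have h7 : 2 ^ (L ^ 10 + 26 * L) = 2 ^ (L ^ 10 + 26 * L - 1) * 2 := by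
      rw [← pow_succ]; congr 1; omega
    omega
  have h2 : (1 + D₂) ^ m ≤ 2 ^ (L * (3 * L * L + 1)) := by
    rw [pow_mul, hm]; exact Nat.pow_le_pow_left hD₂ _
  have h3 : w₀ + (w₀ ^ 2 + (w₀ + B) * D) * (1 + D₂) ^ m ≤ 2 ^ E := by
    have h4 := Nat.mul_le_mul h1 h2
    rw [← pow_add] at h4
    have h5 : 2 ^ (L ^ 10 + 26 * L + L * (3 * L * L + 1)) ≤ 2 ^ (E - 1) :=
      Nat.pow_le_pow_right (by norm_num) (by omega)
    have h6 : 2 ^ L ≤ 2 ^ (E - 1) := Nat.pow_le_pow_right (by norm_num) (by omega)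
    have h7 : 2 ^ E = 2 ^ (E - 1) * 2 := by rw [← pow_succ]; congr 1; omega
    omega
  have h4 : 2 * E + 5 ≤ L ^ 16 := by
    have h5 : L ≤ L ^ 10 := Nat.le_self_pow (by norm_num) L
    have h6 : L * (3 * L * L + 1) = 3 * L ^ 3 + L := by ring
    have h7 : L ^ 3 ≤ L ^ 10 := Nat.pow_le_pow_right (by omega) (by norm_num)
    calc 2 * E + 5 ≤ 100 * L ^ 10 := by omega
      _ ≤ L * L ^ 10 := Nat.mul_le_mul_right _ hL
      _ = L ^ 11 := by ring
      _ ≤ L ^ 16 := Nat.pow_le_pow_right (by omega) (by norm_num)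
  generalize w₀ + (w₀ ^ 2 + (w₀ + B) * D) * (1 + D₂) ^ m = z at h3 ⊢
  have h5 : z ^ 2 ≤ 2 ^ (2 * E) := by
    rw [mul_comm, pow_mul]; exact Nat.pow_le_pow_left h3 2
  have h6 : 2 ^ E ≤ 2 ^ (2 * E) := Nat.pow_le_pow_right (by norm_num) (by omega)
  have h7 : 2 ^ (2 * E + 5) ≤ 2 ^ (L ^ 16) := Nat.pow_le_pow_right (by norm_num) h4
  rw [pow_add] at h7
  omega

lemma small_poor_count_le {L b w₀ : ℕ} (hL : 100 ≤ L) (hb : b ≤ L ^ 5) (hw : w₀ + 1 ≤ 2 ^ L) :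
    (b * L ^ 4) * ((L ^ 4 + 1) * ((L ^ 4 * b + 1) * (w₀ + 1) ^ (L ^ 4 * b))) ≤
      2 ^ (L ^ 10 + 24 * L) := by
  have h0 : L ≤ 2 ^ L := Nat.lt_two_pow_self.le
  have hp : ∀ j, L ^ j ≤ 2 ^ (L * j) := fun j => by
    rw [pow_mul]; exact Nat.pow_le_pow_left h0 j
  have h1 : b * L ^ 4 ≤ 2 ^ (L * 9) := by
    calc b * L ^ 4 ≤ L ^ 5 * L ^ 4 := Nat.mul_le_mul_right _ hb
      _ = L ^ 9 := by ring
      _ ≤ _ := hp 9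
  have h2 : L ^ 4 + 1 ≤ 2 ^ (L * 5) := by
    calc L ^ 4 + 1 ≤ L ^ 4 + L ^ 4 := by gcongr; exact Nat.one_le_pow _ _ (by omega)
      _ = 2 * L ^ 4 := by ring
      _ ≤ L * L ^ 4 := Nat.mul_le_mul_right _ (by omega)
      _ = L ^ 5 := by ring
      _ ≤ _ := hp 5
  have h3 : L ^ 4 * b ≤ L ^ 9 := by
    calc L ^ 4 * b ≤ L ^ 4 * L ^ 5 := Nat.mul_le_mul_left _ hb
      _ = L ^ 9 := by ring
  have h4 : L ^ 4 * b + 1 ≤ 2 ^ (L * 10) := by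
    calc L ^ 4 * b + 1 ≤ L ^ 9 + L ^ 9 := add_le_add h3 (Nat.one_le_pow _ _ (by omega))
      _ = 2 * L ^ 9 := by ring
      _ ≤ L * L ^ 9 := Nat.mul_le_mul_right _ (by omega)
      _ = L ^ 10 := by ring
      _ ≤ _ := hp 10
  have h5 : (w₀ + 1) ^ (L ^ 4 * b) ≤ 2 ^ (L ^ 10) := by
    calc (w₀ + 1) ^ (L ^ 4 * b) ≤ (w₀ + 1) ^ (L ^ 9) := Nat.pow_le_pow_right (by omega) h3
      _ ≤ (2 ^ L) ^ (L ^ 9) := Nat.pow_le_pow_left hw _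
      _ = 2 ^ (L ^ 10) := by rw [← pow_mul]; congr 1; ring
  calc _ ≤ 2 ^ (L * 9) * (2 ^ (L * 5) * (2 ^ (L * 10) * 2 ^ (L ^ 10))) := by gcongr
    _ = 2 ^ (L ^ 10 + 24 * L) := by
      rw [← pow_add, ← pow_add, ← pow_add]; congr 1; ring

lemma two_pow_le_of_le_log {n e : ℕ} (h : (e : ℝ) ≤ Real.log n) (hn : 0 < n) : 2 ^ e ≤ n := by
  have h1 : Real.exp e ≤ n := by
    rwa [← Real.le_log_iff_exp_le (by exact_mod_cast hn)]
  have h2 : (2 : ℝ) ^ e ≤ Real.exp e := by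
    rw [← Real.exp_one_pow]
    exact pow_le_pow_left₀ (by norm_num) (by linarith [Real.add_one_le_exp (1 : ℝ)]) _
  exact_mod_cast h2.trans h1

lemma log_two_succ_le {n R : ℕ} (h : Real.log n ≤ R) (hn : 0 < n) (hR : 2 ≤ R) :
    Nat.log 2 n + 1 ≤ 2 * R := by
  have h1 : ((2 : ℝ)) ^ Nat.log 2 n ≤ n := by exact_mod_cast Nat.pow_log_le_self 2 hn.ne'
  have h2 := Real.log_le_log (by positivity) h1
  rw [Real.log_pow] at h2
  have h3 := Real.log_two_gt_d9
  have h4 : (2 : ℝ) ≤ R := by exact_mod_cast hR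
  have h5 : (0 : ℝ) ≤ Nat.log 2 n := Nat.cast_nonneg _
  have h6 : ((Nat.log 2 n + 1 : ℕ) : ℝ) ≤ (2 * R : ℕ) := by
    push_cast
    nlinarith
  exact_mod_cast h6

section
variable [Fintype V]

set_option maxHeartbeats 2000000 in
lemma containsBalSub_of_large {G : SimpleGraph V} {f : V → Bool} {ε₂ d : ℝ} {L R M κ : ℕ}
    (hf : ∀ u v, G.Adj u v → f u ≠ f v) (hε : ε₂ < 1 / 5)
    (hG : IsExpander G 1 (ε₂ * d)) (hd : 9000 ≤ d) (hεd : 15 ≤ ε₂ * d)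
    (hfree : ¬ ContainsBalSub G ⌈d / 2⌉₊ 2)
    (hdeg : ∀ v, ⌈d⌉₊ ≤ (nbrIn G v Finset.univ).card) (hV : 0 < Fintype.card V)
    (hL : 100 ≤ L) (hLn : (L : ℝ) ^ 16 ≤ Real.log (Fintype.card V))
    (hnR : Real.log (Fintype.card V) ≤ R) (hR : 10 ^ 4 ≤ R) (hRM : R ≤ M) (hbM : ⌈d⌉₊ ≤ M)
    (hκM : κ ≤ M) (hκ : 1 ≤ κ) (hdκ : d ≤ R * κ) (hML : M ^ 22 ≤ 2 ^ L)
    (hlogM : 968 * Real.log M ^ 2 < L) (hbL : ε₂ * d / 2 ≤ (L : ℝ) ^ 4 → ⌈d⌉₊ ≤ L ^ 5)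
    (hlog : ∀ x e : ℕ, ε₂ * d / 2 ≤ x → e ^ 4 < x ^ 3 →
      Real.log (15 * (⌈d⌉₊ * x ^ 2 : ℕ) / (ε₂ * d)) ^ 2 * (1 + e) < x)
    (c : Fin κ → V) (hc : Function.Injective c) (hcf : ∀ i j, f (c i) = f (c j))
    (hcdeg : ∀ i, 17 * (κ ^ 2 * R ^ 9) ≤ (nbrIn G (c i) Finset.univ).card) :
    ∃ ℓ, ContainsBalSub G κ ℓ := by
  classical
  have hk : 0 < ε₂ * d := by linarith
  have hM : 10 ^ 4 ≤ M := hR.trans hRM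
  have hd0 : (0 : ℝ) < d := by linarith
  have hbd : d ≤ (⌈d⌉₊ : ℝ) := Nat.le_ceil d
  have hb9 : 9000 ≤ ⌈d⌉₊ := by
    have : (9000 : ℝ) ≤ (⌈d⌉₊ : ℝ) := hd.trans hbd
    exact_mod_cast this
  set n := Fintype.card V with hn
  have hn2 : 2 ^ (L ^ 16) ≤ n := two_pow_le_of_le_log (by exact_mod_cast hLn) hV
  set a := Nat.log 2 n + 1 with ha
  have haR : a ≤ 2 * R := log_two_succ_le hnR hV (by omega)
  set m := 3 * L * L + 1 with hm
  have hLR : L ^ 16 ≤ R := by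
    have : (L : ℝ) ^ 16 ≤ R := hLn.trans hnR
    exact_mod_cast this
  have hmR : m ≤ R := by
    refine le_trans ?_ hLR
    calc m = 3 * (L * L) + 1 := by rw [hm]; ring
      _ ≤ 100 * (L * L) := by nlinarith
      _ ≤ L * (L * L) := Nat.mul_le_mul_right _ hL
      _ = L ^ 3 := by ring
      _ ≤ L ^ 16 := Nat.pow_le_pow_right (by omega) (by norm_num)
  obtain ⟨ρ, hρ⟩ : ∃ ρ, ρ = 2 * (m + 8 * R ^ 2 * a) := ⟨_, rfl⟩
  obtain ⟨η, hη⟩ : ∃ η, η = ρ + a := ⟨_, rfl⟩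
  obtain ⟨ℓ, hℓ⟩ : ∃ ℓ, ℓ = 2 * (η * (η + 2)) := ⟨_, rfl⟩
  have hηR := path_length_le hR hmR haR hρ hη
  have hused := used_vertices_le hR hκ hηR hℓ
  obtain ⟨w₀, hw₀⟩ : ∃ w₀, w₀ = κ ^ 2 * R ^ 7 := ⟨_, rfl⟩
  obtain ⟨D, hD⟩ : ∃ D, D = 16 * R ^ 2 * w₀ := ⟨_, rfl⟩
  have hR1 : 1 ≤ R := by omega
  have hw1 : 1 ≤ w₀ := hw₀ ▸ Nat.mul_pos (Nat.pow_pos hκ) (Nat.pow_pos hR1)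
  have hD1 : 1 ≤ D := hD ▸ Nat.mul_pos (Nat.mul_pos (by norm_num) (Nat.pow_pos hR1)) hw1
  have hwM : w₀ ≤ M ^ 9 := by
    calc w₀ = κ ^ 2 * R ^ 7 := hw₀
      _ ≤ M ^ 2 * M ^ 7 := by gcongr
      _ = M ^ 9 := by ring
  have hDM : D ≤ M ^ 12 := by
    calc D = 16 * R ^ 2 * w₀ := hD
      _ ≤ M * M ^ 2 * M ^ 9 := by gcongr; omega
      _ = M ^ 12 := by ring
  have hpow : ∀ i ≤ 22, M ^ i ≤ 2 ^ L := fun i hi =>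
    (Nat.pow_le_pow_right (by omega) hi).trans hML
  obtain ⟨D₂, hD₂⟩ : ∃ D₂, D₂ = D + w₀ + ρ + (2 * a + 4) := ⟨_, rfl⟩
  have hD₂M : 1 + D₂ ≤ M ^ 13 := by
    have h1 : M ^ 9 ≤ M ^ 12 := Nat.pow_le_pow_right (by omega) (by norm_num)
    have h2 : R ^ 3 ≤ M ^ 12 :=
      (Nat.pow_le_pow_left hRM 3).trans (Nat.pow_le_pow_right (by omega) (by norm_num))
    have h3 : M ≤ M ^ 12 := Nat.le_self_pow (by norm_num) M
    calc 1 + D₂ ≤ 10 ^ 4 * M ^ 12 := by omega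
      _ ≤ M * M ^ 12 := by gcongr
      _ = M ^ 13 := by ring
  obtain ⟨B, hB⟩ : ∃ B, B = if ε₂ * d / 2 ≤ (L : ℝ) ^ 4 then (⌈d⌉₊ * L ^ 4) * ((L ^ 4 + 1) *
      ((L ^ 4 * ⌈d⌉₊ + 1) * (w₀ + 1) ^ (L ^ 4 * ⌈d⌉₊))) else 0 := ⟨_, rfl⟩
  have hw1L : w₀ + 1 ≤ 2 ^ L := by
    refine le_trans ?_ (hpow 10 (by norm_num))
    calc w₀ + 1 ≤ M ^ 9 + M ^ 9 := add_le_add hwM (Nat.one_le_pow _ _ (by omega))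
      _ = 2 * M ^ 9 := by ring
      _ ≤ M * M ^ 9 := Nat.mul_le_mul_right _ (by omega)
      _ = M ^ 10 := by ring
  have hBle : B ≤ 2 ^ (L ^ 10 + 24 * L) := by
    rw [hB]
    split_ifs with h
    · exact small_poor_count_le hL (hbL h) hw1L
    · exact Nat.zero_le _
  have hL16 : 4 * L + 1 ≤ L ^ 16 := by
    calc 4 * L + 1 ≤ 100 * L := by omega
      _ ≤ L * L := Nat.mul_le_mul_right _ hL
      _ = L ^ 2 := by ring
      _ ≤ L ^ 16 := Nat.pow_le_pow_right (by omega) (by norm_num)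
  have hn4 : 2 * (2 ^ L * (2 ^ L * (2 ^ L * 2 ^ L))) ≤ n := by
    refine le_trans (le_of_eq ?_) ((Nat.pow_le_pow_right (by norm_num) hL16).trans hn2)
    rw [← pow_add, ← pow_add, ← pow_add, ← pow_succ']; congr 1; ring
  have h2L : 1 ≤ 2 ^ L := Nat.one_le_two_pow
  have hkw : ε₂ * d ≤ w₀ := by
    have h1 : ε₂ * d ≤ d := by nlinarith
    have h2 : R * κ ≤ w₀ := by
      rw [hw₀, mul_comm]
      exact Nat.mul_le_mul (Nat.le_self_pow (by norm_num) κ) (Nat.le_self_pow (by norm_num) R)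
    have h3 : ((R * κ : ℕ) : ℝ) ≤ w₀ := by exact_mod_cast h2
    push_cast at h3
    linarith
  refine ⟨ℓ, containsBalSub_of_parameters (w₀ := w₀) (D := D) (D₂ := D₂) (L := L)
    (q := ⌈d / 2⌉₊) (b := ⌈d⌉₊) (B := B) (R := R) (a := a) (m := m) (δ := (⌈d⌉₊ + 4) / 5)
    (k₀ := ⌈ε₂ * d / 2⌉₊) (η := η) (ρ := ρ) hf hG hk hfree hdeg ?_ (Nat.mul_div_le _ _) (by omega)
    ?_ (Nat.le_ceil _) hkw hR1 ?_ ?_ hlog ?_ ?_ ?_ ?_ ?_ hD.ge hρ hη hD₂.ge le_rfl (by omega)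
    (hDM.trans (hpow 12 (by norm_num))) ?_ (hℓ ▸ even_two_mul _) ?_ (hw₀ ▸ hused) c hc hcf
    fun i => ?_⟩
  · have h1 : ⌈d / 2⌉₊ ≤ (⌈d⌉₊ + 1) / 2 := by
      rw [Nat.ceil_le]
      have h2 : ⌈d⌉₊ ≤ 2 * ((⌈d⌉₊ + 1) / 2) := by omega
      have h3 : (⌈d⌉₊ : ℝ) ≤ 2 * ((⌈d⌉₊ + 1) / 2 : ℕ) := by exact_mod_cast h2
      linarith
    omega
  · have h1 : ⌈ε₂ * d / 2⌉₊ ≤ ⌈d⌉₊ / 10 + 1 := by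
      rw [Nat.ceil_le]
      have h2 : ⌈d⌉₊ ≤ 10 * (⌈d⌉₊ / 10 + 1) := by omega
      have h3 : (⌈d⌉₊ : ℝ) ≤ 10 * ((⌈d⌉₊ / 10 + 1 : ℕ) : ℝ) := by exact_mod_cast h2
      nlinarith
    omega
  · refine (Real.log_le_log (by positivity) (?_ : _ ≤ (n : ℝ))).trans (hnR.trans ?_)
    · rw [div_le_iff₀ hk]
      nlinarith [show (0 : ℝ) ≤ n from Nat.cast_nonneg _]
    · linarith [show (0 : ℝ) ≤ R from Nat.cast_nonneg _]
  · have hwD : (w₀ : ℝ) * D ≤ M ^ 22 := by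
      have : w₀ * D ≤ M ^ 22 :=
        calc w₀ * D ≤ M ^ 9 * M ^ 12 := Nat.mul_le_mul hwM hDM
          _ = M ^ 21 := by ring
          _ ≤ M ^ 22 := Nat.pow_le_pow_right (by omega) (by norm_num)
      exact_mod_cast this
    have hD1' : (1 : ℝ) ≤ D := by exact_mod_cast hD1
    have hw0' : (0 : ℝ) ≤ w₀ := Nat.cast_nonneg _
    have h1 : (1 : ℝ) ≤ 15 * (w₀ * D : ℕ) / (ε₂ * d) := by
      rw [le_div_iff₀ hk]; push_cast; nlinarith
    have h2 : 15 * (w₀ * D : ℕ) / (ε₂ * d) ≤ (M : ℝ) ^ 22 := by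
      rw [div_le_iff₀ hk]; push_cast
      have h0 : (M : ℝ) ^ 22 * 15 ≤ (M : ℝ) ^ 22 * (ε₂ * d) :=
        mul_le_mul_of_nonneg_left hεd (by positivity)
      linarith
    have h3 := Real.log_nonneg h1
    have h4 := Real.log_le_log (by linarith) h2
    rw [Real.log_pow] at h4
    have h5 := pow_le_pow_left₀ h3 h4 2
    push_cast at h5
    nlinarith
  · calc 2 * (w₀ * D) ≤ 2 * (2 ^ L * (2 ^ L * (2 ^ L * 2 ^ L))) := by
          gcongr
          · omega
          · exact (hDM.trans (hpow 12 (by norm_num))).trans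
              (Nat.le_mul_of_pos_right _ (by positivity))
      _ ≤ n := hn4
  · have h1 : L ^ 4 ≤ 2 ^ L := by
      refine le_trans (Nat.pow_le_pow_left ?_ 4) (hpow 4 (by norm_num))
      exact (Nat.le_self_pow (by norm_num) L).trans (hLR.trans hRM)
    calc 2 * (⌈d⌉₊ * (L ^ 4) ^ 2) ≤ 2 * (2 ^ L * (2 ^ L) ^ 2) := by
          gcongr
          exact hbM.trans (by simpa using hpow 1 (by norm_num))
      _ = 2 * (2 ^ L * (2 ^ L * 2 ^ L)) := by ring
      _ ≤ 2 * (2 ^ L * (2 ^ L * (2 ^ L * 2 ^ L))) := by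
          gcongr
          exact Nat.le_mul_of_pos_right _ (by positivity)
      _ ≤ n := hn4
  · intro h
    rw [hB, if_pos h]
  · exact Nat.lt_pow_succ_log_self (by norm_num) n
  · exact forbidden_card_le hL hm (by omega) (hDM.trans (hpow 12 (by norm_num)))
      (hD₂M.trans (hpow 13 (by norm_num))) hBle hn2
  · calc (2 * a + 40) ^ 2 ≤ (M * M) ^ 2 := by
          refine Nat.pow_le_pow_left ?_ 2
          calc 2 * a + 40 ≤ 10 ^ 4 * M := by omega
            _ ≤ M * M := Nat.mul_le_mul_right _ hM
      _ = M ^ 4 := by ring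
      _ ≤ 2 ^ L := hpow 4 (by norm_num)
      _ ≤ _ := Nat.pow_le_pow_right (by norm_num) (Nat.le_sub_one_of_lt (by nlinarith))
  · rw [hℓ]; nlinarith
  · refine le_trans ?_ (hcdeg i)
    rw [hD, hw₀]
    have h1 : R ^ 7 ≤ R ^ 9 := Nat.pow_le_pow_right (by omega) (by norm_num)
    calc 16 * R ^ 2 * (κ ^ 2 * R ^ 7) + κ ^ 2 * R ^ 7
        ≤ 16 * R ^ 2 * (κ ^ 2 * R ^ 7) + κ ^ 2 * R ^ 9 := by gcongr
      _ = 17 * (κ ^ 2 * R ^ 9) := by ring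

end

lemma mul_sq_mul_pow_le {N y κ R : ℝ} (hN : 2176 ≤ N) (hκ0 : 0 ≤ κ) (hκ : κ ≤ y / 2) (hR0 : 0 ≤ R)
    (hR : R ≤ 2 * N) : 17 * (κ ^ 2 * R ^ 9) ≤ y ^ 2 * N ^ 10 := by
  have hN0 : 0 ≤ N := by linarith
  calc 17 * (κ ^ 2 * R ^ 9) ≤ 17 * ((y / 2) ^ 2 * (2 * N) ^ 9) := by gcongr
    _ = y ^ 2 * N ^ 9 * 2176 := by ring
    _ ≤ y ^ 2 * N ^ 9 * N := mul_le_mul_of_nonneg_left hN (by positivity)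
    _ = y ^ 2 * N ^ 10 := by ring

lemma eventually_mul_log_pow_lt (C : ℝ) (k : ℕ) :
    ∀ᶠ x : ℝ in Filter.atTop, C * Real.log x ^ k < x := by
  have hC : 0 < |C| + 1 := by positivity
  filter_upwards [(isLittleO_pow_log_id_atTop (n := k)).def (inv_pos.mpr hC),
    Filter.eventually_gt_atTop 1] with x hx hx1
  have hl := Real.log_pos hx1
  simp only [id, Real.norm_eq_abs] at hx
  rw [abs_of_pos (a := Real.log x ^ k) (by positivity), abs_of_pos (a := x) (by linarith),
    inv_mul_eq_div, le_div_iff₀ hC] at hx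
  have h1 : C ≤ |C| := le_abs_self C
  have h2 : 0 < Real.log x ^ k := by positivity
  nlinarith

lemma eventually_log_sq_mul_lt {A : ℝ} (hA : 0 < A) :
    ∃ x₀ : ℝ, 0 < x₀ ∧ ∀ (x e : ℕ) (y : ℝ), x₀ ≤ x → e ^ 4 < x ^ 3 → 1 ≤ y → y ≤ A * (x : ℝ) ^ 2 →
      Real.log y ^ 2 * (1 + e) < x := by
  obtain ⟨x₁, hx₁⟩ := Filter.eventually_atTop.mp (eventually_mul_log_pow_lt (18 ^ 4) 8)
  refine ⟨max x₁ (max A 1), by positivity, fun x e y hx he hy hyx => ?_⟩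
  have h8 := hx₁ x ((le_max_left _ _).trans hx)
  have hAx : A ≤ x := ((le_max_left _ _).trans (le_max_right _ _)).trans hx
  have h1x : (1 : ℝ) ≤ x := ((le_max_right _ _).trans (le_max_right _ _)).trans hx
  have hx0 : (0 : ℝ) < x := by linarith
  have hlog : Real.log y ≤ 3 * Real.log x := by
    have : y ≤ (x : ℝ) ^ 3 := hyx.trans (by nlinarith [pow_pos hx0 2])
    have := Real.log_le_log (by linarith) this
    rwa [Real.log_pow] at this
  have hy0 := Real.log_nonneg hy
  obtain ⟨E, hE⟩ : ∃ E, E = max (e : ℝ) 1 := ⟨_, rfl⟩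
  have hE1 : 1 ≤ E := hE ▸ le_max_right _ _
  have heE : (e : ℝ) ≤ E := hE ▸ le_max_left _ _
  have hE4 : E ^ 4 ≤ (x : ℝ) ^ 3 := by
    rcases le_total (e : ℝ) 1 with h | h
    · rw [hE, max_eq_right h, one_pow]
      exact one_le_pow₀ h1x
    · rw [hE, max_eq_left h]
      exact_mod_cast he.le
  have h2 : Real.log y ^ 2 ≤ 9 * Real.log x ^ 2 := by
    have := pow_le_pow_left₀ hy0 hlog 2
    linarith [mul_pow 3 (Real.log x) 2]
  have h3 : 18 * Real.log x ^ 2 * E < x := by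
    refine lt_of_pow_lt_pow_left₀ 4 hx0.le ?_
    calc (18 * Real.log x ^ 2 * E) ^ 4 = 18 ^ 4 * Real.log x ^ 8 * E ^ 4 := by ring
      _ ≤ 18 ^ 4 * Real.log x ^ 8 * (x : ℝ) ^ 3 := by gcongr
      _ < x * (x : ℝ) ^ 3 := by gcongr
      _ = (x : ℝ) ^ 4 := by ring
  calc Real.log y ^ 2 * (1 + e) ≤ (9 * Real.log x ^ 2) * (2 * E) := by
        gcongr
        linarith
    _ = 18 * Real.log x ^ 2 * E := by ring
    _ < x := h3

lemma eventually_log_pow_sq_lt (p : ℕ) :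
    ∃ L₀ : ℕ, ∀ L : ℕ, L₀ ≤ L → 968 * Real.log (((L + 1) ^ p : ℕ) : ℝ) ^ 2 < L := by
  obtain ⟨x₁, hx₁⟩ := Filter.eventually_atTop.mp
    (eventually_mul_log_pow_lt (2 * (968 * (p : ℝ) ^ 2)) 2)
  refine ⟨max ⌈x₁⌉₊ 1, fun L hL => ?_⟩
  have h1 : x₁ ≤ (L : ℝ) := (Nat.le_ceil x₁).trans
    (by exact_mod_cast (le_max_left _ _).trans hL)
  have h2 : (1 : ℝ) ≤ L := by exact_mod_cast (le_max_right _ _).trans hL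
  have h3 := hx₁ ((L : ℝ) + 1) (by linarith)
  push_cast
  rw [Real.log_pow, mul_pow]
  linarith

lemma pow_le_two_pow_of_log_sq_lt {M L : ℕ} (hM : 0 < M) (hL : 2 ≤ L)
    (h : 968 * Real.log M ^ 2 < L) : M ^ 22 ≤ 2 ^ L := by
  have h1 : (22 : ℕ) * Real.log M ≤ L * Real.log 2 := by
    have h2 := Real.log_two_gt_d9
    have h3 : (2 : ℝ) ≤ L := by exact_mod_cast hL
    push_cast
    nlinarith [sq_nonneg (22 * Real.log M - 1 / 2)]
  rw [← Real.log_pow, ← Real.log_pow] at h1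
  have := (Real.log_le_log_iff (by positivity) (by positivity)).mp h1
  exact_mod_cast this

lemma exists_nat_pow_le_lt {N : ℝ} (hN : 0 ≤ N) {k : ℕ} (hk : k ≠ 0) :
    ∃ L : ℕ, (L : ℝ) ^ k ≤ N ∧ N < ((L : ℝ) + 1) ^ k := by
  have h0 : 0 ≤ N ^ ((k : ℝ)⁻¹) := by positivity
  refine ⟨⌊N ^ ((k : ℝ)⁻¹)⌋₊, ?_, ?_⟩
  · calc _ ≤ (N ^ ((k : ℝ)⁻¹)) ^ k := pow_le_pow_left₀ (by positivity) (Nat.floor_le h0) k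
      _ = N := Real.rpow_inv_natCast_pow hN hk
  · calc N = (N ^ ((k : ℝ)⁻¹)) ^ k := (Real.rpow_inv_natCast_pow hN hk).symm
      _ < _ := pow_lt_pow_left₀ (Nat.lt_floor_add_one _) h0 hk

section
variable [Fintype V]

lemma card_nbrIn_univ (G : SimpleGraph V) (v : V) :
    (nbrIn G v Finset.univ).card = (G.neighborSet v).ncard := by
  rw [← Set.ncard_coe_finset]
  congr 1
  ext u
  simp [mem_nbrIn]

lemma exists_injective_same_side (f : V → Bool) (H : Set V) {t : ℝ}
    (hH : 2 * t ≤ (H.ncard : ℝ)) :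
    ∃ c : Fin ⌈t⌉₊ → V, Function.Injective c ∧ (∀ i, c i ∈ H) ∧ ∀ i j, f (c i) = f (c j) := by
  classical
  obtain ⟨β, hβ⟩ : ∃ β, t ≤ ((H ∩ {v | f v = β}).ncard : ℝ) := by
    by_contra! hcon
    have h1 : H ⊆ (H ∩ {v | f v = true}) ∪ (H ∩ {v | f v = false}) := by
      intro v hv
      cases h : f v
      · exact Or.inr ⟨hv, h⟩
      · exact Or.inl ⟨hv, h⟩
    have h2 := (Set.ncard_le_ncard h1 (Set.toFinite _)).trans (Set.ncard_union_le _ _)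
    have h3 : (H.ncard : ℝ) ≤ (H ∩ {v | f v = true}).ncard + (H ∩ {v | f v = false}).ncard := by
      exact_mod_cast h2
    linarith [hcon true, hcon false]
  have h4 : ⌈t⌉₊ ≤ (H ∩ {v | f v = β}).toFinset.card := by
    rw [← Set.ncard_eq_toFinset_card']
    exact Nat.ceil_le.mpr hβ
  obtain ⟨S, hS, hcard⟩ := Finset.exists_subset_card_eq h4
  refine ⟨fun i => ((S.equivFinOfCardEq hcard).symm i : V), fun i j hij => ?_, fun i => ?_,
    fun i j => ?_⟩
  · exact (S.equivFinOfCardEq hcard).symm.injective (Subtype.ext hij)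
  · have := hS ((S.equivFinOfCardEq hcard).symm i).2
    rw [Set.mem_toFinset] at this
    exact this.1
  · have h5 := hS ((S.equivFinOfCardEq hcard).symm i).2
    have h6 := hS ((S.equivFinOfCardEq hcard).symm j).2
    rw [Set.mem_toFinset] at h5 h6
    exact h5.2.trans h6.2.symm

end

/-- the sparse case when many vertices have large degree (Lemma 4.2). -/
theorem statement7 :
    ∃ ε₁ : ℝ, 0 < ε₁ ∧
      ∀ ε₂ : ℝ, 0 < ε₂ → ε₂ < 1 / 5 → ∀ c : ℝ, 0 < c → ∀ s : ℝ, 20 ≤ s →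
        ∃ (d₀ t₃ : ℝ), 0 < t₃ ∧ t₃ < c / 3 ∧
          ∀ (n : ℕ) (d : ℝ), d₀ ≤ d → d ≤ n → d < Real.log n ^ s →
            ∀ (V : Type) [Fintype V] (G : SimpleGraph V), Nat.card V = n →
              IsBip G → IsExpander G ε₁ (ε₂ * d) → MinDegGE G d →
                ¬ ContainsBalSub G ⌈d / 2⌉₊ 2 →
                2 * t₃ * d ≤
                  (({v : V | c ^ 2 * d ^ 2 * Real.log n ^ 10 ≤
                    ((G.neighborSet v).ncard : ℝ)} : Set V).ncard : ℝ) →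
                ∃ (k ℓ : ℕ), t₃ * d ≤ (k : ℝ) ∧ ContainsBalSub G k ℓ := by
  refine ⟨1, one_pos, fun ε₂ hε0 hε c hc s hs => ?_⟩
  obtain ⟨S, hS⟩ : ∃ S, S = ⌈s⌉₊ := ⟨_, rfl⟩
  have hsS : s ≤ S := hS ▸ Nat.le_ceil s
  have hS1 : 1 ≤ S := by
    have : (1 : ℝ) ≤ S := by linarith
    exact_mod_cast this
  obtain ⟨x₀, hx0, hx₀⟩ := eventually_log_sq_mul_lt (A := 30 / ε₂) (by positivity)
  obtain ⟨L₁, hL₁⟩ := eventually_log_pow_sq_lt (16 * S + 1)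
  obtain ⟨L₀, hL₀⟩ : ∃ L₀, L₀ = L₁ + 100 + ⌈c⌉₊ + ⌈4 / c⌉₊ + (⌈2 / ε₂⌉₊ + 1) := ⟨_, rfl⟩
  refine ⟨Real.exp ((L₀ : ℝ) ^ 16) + 9000 + 15 / ε₂ + 4 / c + 2 * x₀ / ε₂, c / 4, by positivity,
    by linarith, fun n d hd hdn hds V _ G hVn ⟨f, hf⟩ hG hmin hfree hH => ?_⟩
  have he := Real.exp_pos ((L₀ : ℝ) ^ 16)
  have p1 : 0 < 15 / ε₂ := by positivity
  have p2 : 0 < 4 / c := by positivity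
  have p3 : 0 < 2 * x₀ / ε₂ := by positivity
  have hd9 : 9000 ≤ d := by linarith
  have hd0 : 0 < d := by linarith
  have hεd : 15 ≤ ε₂ * d := by
    rw [mul_comm, ← div_le_iff₀ hε0]; linarith
  have hcd : 4 ≤ c * d := by
    rw [mul_comm, ← div_le_iff₀ hc]; linarith
  have hxd : 2 * x₀ ≤ ε₂ * d := by
    rw [mul_comm ε₂, ← div_le_iff₀ hε0]; linarith
  have hn0 : (0 : ℝ) < n := by linarith
  obtain ⟨N, hN⟩ : ∃ N, N = Real.log n := ⟨_, rfl⟩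
  rw [← hN] at hds hH
  have hLN : (L₀ : ℝ) ^ 16 ≤ N := by
    rw [hN, Real.le_log_iff_exp_le hn0]; linarith
  obtain ⟨L, hL1, hL2⟩ := exists_nat_pow_le_lt ((by positivity : (0 : ℝ) ≤ (L₀ : ℝ) ^ 16).trans hLN)
    (k := 16) (by norm_num)
  have hLL : L₀ ≤ L := by
    have : (L₀ : ℝ) < (L : ℝ) + 1 := lt_of_pow_lt_pow_left₀ 16 (by positivity) (hLN.trans_lt hL2)
    exact Nat.lt_succ_iff.mp (by exact_mod_cast this)
  have hL100 : 100 ≤ L := by omega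
  have hLr : (100 : ℝ) ≤ L := by exact_mod_cast hL100
  have hcL : c ≤ L := (Nat.le_ceil c).trans (by exact_mod_cast (by omega : ⌈c⌉₊ ≤ L))
  have hcL2 : 4 / c ≤ L := (Nat.le_ceil _).trans (by exact_mod_cast (by omega : ⌈4 / c⌉₊ ≤ L))
  have hεL : 2 / ε₂ ≤ L := (Nat.le_ceil _).trans (by exact_mod_cast (by omega : ⌈2 / ε₂⌉₊ ≤ L))
  have hL16 : (L : ℝ) ≤ (L : ℝ) ^ 16 := le_self_pow₀ (by linarith) (by norm_num)
  have hN4 : 10 ^ 4 ≤ N := by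
    calc (10 : ℝ) ^ 4 ≤ 100 ^ 16 := by norm_num
      _ ≤ (L : ℝ) ^ 16 := by gcongr
      _ ≤ N := hL1
  obtain ⟨M, hM⟩ : ∃ M, M = (L + 1) ^ (16 * S + 1) := ⟨_, rfl⟩
  have hlogM : 968 * Real.log M ^ 2 < L := by
    rw [hM]; exact hL₁ L (by omega)
  have hdM : d ≤ (((L + 1) ^ (16 * S) : ℕ) : ℝ) := by
    calc d ≤ N ^ s := hds.le
      _ ≤ N ^ (S : ℝ) := Real.rpow_le_rpow_of_exponent_le (by linarith) hsS
      _ = N ^ S := Real.rpow_natCast _ _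
      _ ≤ (((L : ℝ) + 1) ^ 16) ^ S := pow_le_pow_left₀ (by linarith) hL2.le S
      _ = _ := by push_cast; rw [pow_mul]
  have hVcard : Fintype.card V = n := by rw [← Nat.card_eq_fintype_card, hVn]
  obtain ⟨cf, hinj, hmem, hside⟩ := exists_injective_same_side f _ (t := c / 4 * d)
    ((by ring : 2 * (c / 4 * d) = 2 * (c / 4) * d).trans_le hH)
  have hκ1 : c / 4 * d ≤ (⌈c / 4 * d⌉₊ : ℝ) := Nat.le_ceil _
  have hκ2 : (⌈c / 4 * d⌉₊ : ℝ) ≤ c * d / 2 := by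
    have := Nat.ceil_lt_add_one (a := c / 4 * d) (by positivity)
    linarith
  have hR1 : N ≤ (⌈N⌉₊ : ℝ) := Nat.le_ceil _
  have hR2 : (⌈N⌉₊ : ℝ) ≤ 2 * N := by
    have := Nat.ceil_lt_add_one (a := N) (by linarith)
    linarith
  have hdeg : ∀ v, ⌈d⌉₊ ≤ (nbrIn G v Finset.univ).card := fun v => by
    rw [card_nbrIn_univ]; exact Nat.ceil_le.mpr (hmin v)
  have hd2 : (⌈d⌉₊ : ℝ) ≤ 2 * d := by
    have := Nat.ceil_lt_add_one hd0.le
    linarith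
  suffices h : ∃ ℓ, ContainsBalSub G ⌈c / 4 * d⌉₊ ℓ from ⟨_, h.choose, hκ1, h.choose_spec⟩
  refine containsBalSub_of_large (R := ⌈N⌉₊) (L := L) (M := M) hf hε hG hd9 hεd hfree hdeg
    (by rw [hVcard]; exact_mod_cast hn0) hL100 (by rw [hVcard, ← hN]; exact hL1)
    (by rw [hVcard, ← hN]; exact hR1) (by exact_mod_cast hN4.trans hR1) ?_ ?_ ?_ ?_ ?_
    (pow_le_two_pow_of_log_sq_lt (hM ▸ by positivity) (by omega) hlogM) hlogM ?_ ?_ cf hinj hside ?_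
  · rw [hM]
    refine le_trans (Nat.ceil_le.mpr ?_) (Nat.pow_le_pow_right (by omega) (by omega : 16 ≤ _))
    exact_mod_cast hL2.le
  · rw [hM]
    exact (Nat.ceil_le.mpr hdM).trans (Nat.pow_le_pow_right (by omega) (by omega))
  · rw [hM, Nat.ceil_le, pow_succ']
    push_cast at hdM ⊢
    exact mul_le_mul (by linarith) hdM hd0.le (by positivity)
  · exact Nat.one_le_iff_ne_zero.mpr (Nat.ceil_pos.mpr (by positivity)).ne'
  · calc d = 4 / c * (c / 4 * d) := by field_simp
      _ ≤ _ := mul_le_mul (by linarith) hκ1 (by positivity) (by positivity)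
  · intro h
    rw [Nat.ceil_le]
    have h1 : d ≤ 2 / ε₂ * (L : ℝ) ^ 4 := by
      rw [div_mul_eq_mul_div, le_div_iff₀ hε0]; linarith
    calc d ≤ 2 / ε₂ * (L : ℝ) ^ 4 := h1
      _ ≤ L * (L : ℝ) ^ 4 := by gcongr
      _ = ((L ^ 5 : ℕ) : ℝ) := by push_cast; ring
  · intro x e hx he
    have hx1 : (1 : ℝ) ≤ (x : ℝ) ^ 2 := one_le_pow₀ (by linarith)
    have hdc : d ≤ (⌈d⌉₊ : ℝ) := Nat.le_ceil d
    refine hx₀ x e _ (by linarith) he ?_ ?_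
    · rw [le_div_iff₀ (by linarith)]
      push_cast
      nlinarith
    · rw [div_le_iff₀ (by linarith)]
      push_cast
      calc 15 * ((⌈d⌉₊ : ℝ) * (x : ℝ) ^ 2) ≤ 15 * (2 * d * (x : ℝ) ^ 2) := by gcongr
        _ = _ := by field_simp; ring
  · intro i
    rw [card_nbrIn_univ]
    have h1 : c ^ 2 * d ^ 2 * N ^ 10 ≤ ((G.neighborSet (cf i)).ncard : ℝ) := hmem i
    have h2 := mul_sq_mul_pow_le (by linarith : 2176 ≤ N) (by positivity) hκ2 (by positivity) hR2
    rw [mul_pow c d 2] at h2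
    exact_mod_cast h2.trans h1

end Balanced
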